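/- arXiv:quant-ph/0510106 — 6 statements merged into one kernel-verified Lean document; each statement's English description precedes it below -/
import Mathlib

section
/- Let p be a prime. Then the quotient group N_in(G)/G of the group N_in(G) of inner automorphisms contained in the normalizer N(G) of the group G = {Ad_{P^iQ^j ⊗ P^kQ^l} : i,j,k,l ∈ ℤ_p} in Aut sl(p²,ℂ) is isomorphic, as a group, to the symplectic group Sp(4, ℤ/pℤ) = {X ∈ (ℤ/pℤ)^{4×4} : Xᵀ J X = J}. -/
open Matrix Kronecker

noncomputable section

def ω (n : ℕ) : ℂ := Complex.exp (2 * Real.pi * Complex.I / n)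

def Pmat (n : ℕ) : Matrix (Fin n) (Fin n) ℂ := Matrix.diagonal fun i => ω n ^ (i : ℕ)

def Qmat (n : ℕ) : Matrix (Fin n) (Fin n) ℂ :=
  Matrix.of fun i j => if (j : ℕ) = ((i : ℕ) + 1) % n then 1 else 0

abbrev slp (n : ℕ) := LieAlgebra.SpecialLinear.sl (Fin n × Fin n) ℂ

abbrev Aut (n : ℕ) := ↥(slp n) ≃ₗ⁅ℂ⁆ ↥(slp n)

instance (n : ℕ) : Group (Aut n) where
  mul f g := g.trans f
  one := LieEquiv.refl
  inv := LieEquiv.symm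
  mul_assoc f g h := LieEquiv.ext fun x => rfl
  one_mul f := LieEquiv.ext fun x => rfl
  mul_one f := LieEquiv.ext fun x => rfl
  inv_mul_cancel f := LieEquiv.ext fun x => f.symm_apply_apply x

def Amat (n : ℕ) : Fin 4 → Matrix (Fin n × Fin n) (Fin n × Fin n) ℂ :=
  ![Pmat n ⊗ₖ 1, Qmat n ⊗ₖ 1, (1 : Matrix (Fin n) (Fin n) ℂ) ⊗ₖ Pmat n,
    (1 : Matrix (Fin n) (Fin n) ℂ) ⊗ₖ Qmat n]

def actsAsAd {n : ℕ} (M : Matrix (Fin n × Fin n) (Fin n × Fin n) ℂ) (φ : Aut n) : Prop :=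
  ∀ X : slp n, (φ X : Matrix (Fin n × Fin n) (Fin n × Fin n) ℂ) = M⁻¹ * (X : Matrix (Fin n × Fin n) (Fin n × Fin n) ℂ) * M

def Gset (n : ℕ) : Set (Aut n) :=
  {φ | ∃ i j k l : ℕ, actsAsAd ((Pmat n ^ i * Qmat n ^ j) ⊗ₖ (Pmat n ^ k * Qmat n ^ l)) φ}

def Nset (n : ℕ) : Set (Aut n) := {g | ∀ h ∈ Gset n, g * h * g⁻¹ ∈ Gset n}

def IsInnerAut {n : ℕ} (φ : Aut n) : Prop :=
  ∃ M : Matrix (Fin n × Fin n) (Fin n × Fin n) ℂ, IsUnit M.det ∧ actsAsAd M φ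

def NinSet (n : ℕ) : Set (Aut n) := {φ | φ ∈ Nset n ∧ IsInnerAut φ}

def J4 (n : ℕ) : Matrix (Fin 4) (Fin 4) (ZMod n) := !![0,1,0,0; -1,0,0,0; 0,0,0,1; 0,0,-1,0]

section Pauli

variable {p : ℕ} [hp : Fact p.Prime]

/-- The Weyl operator `P^i Q^j ⊗ P^k Q^l` with natural number exponents. -/
def weylNat (p i j k l : ℕ) : Matrix (Fin p × Fin p) (Fin p × Fin p) ℂ :=
  (Pmat p ^ i * Qmat p ^ j) ⊗ₖ (Pmat p ^ k * Qmat p ^ l)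

/-- The Weyl operator attached to a vector of `(ℤ/pℤ)⁴`. -/
def weyl (v : Fin 4 → ZMod p) : Matrix (Fin p × Fin p) (Fin p × Fin p) ℂ :=
  weylNat p (v 0).val (v 1).val (v 2).val (v 3).val

theorem omega_pow_eq_stdAddChar (m : ℕ) : ω p ^ m = ZMod.stdAddChar (m : ZMod p) := by
  have h := ZMod.stdAddChar_coe (N := p) (m : ℤ)
  push_cast at h
  rw [h, ω, ← Complex.exp_nat_mul]
  congr 1
  ring

theorem star_omega_mul : star (ω p) * ω p = 1 := by
  have h := omega_pow_eq_stdAddChar (p := p) 1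
  rw [pow_one] at h
  rw [h, ZMod.stdAddChar_apply, Complex.star_def, Complex.conj_mul', Circle.norm_coe]
  simp

omit hp in
theorem Pmat_pow (k : ℕ) :
    Pmat p ^ k = Matrix.diagonal fun i : Fin p => ω p ^ ((i : ℕ) * k) := by
  rw [Pmat, Matrix.diagonal_pow]
  congr 1
  ext i
  simp [pow_mul]

theorem Qmat_pow_apply (k : ℕ) (i j : Fin p) :
    (Qmat p ^ k) i j = if (j : ℕ) = ((i : ℕ) + k) % p then 1 else 0 := by
  induction k generalizing j with
  | zero =>
    simp only [pow_zero, Matrix.one_apply, add_zero, Nat.mod_eq_of_lt i.isLt, Fin.ext_iff]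
    simp only [eq_comm]
  | succ k ih =>
    rw [pow_succ, Matrix.mul_apply]
    simp only [ih]
    rw [Finset.sum_eq_single ⟨((i : ℕ) + k) % p, Nat.mod_lt _ hp.out.pos⟩]
    · simp [Qmat, add_assoc]
    · intro b _ hb
      rw [if_neg, zero_mul]
      intro h
      exact hb (Fin.ext h)
    · simp

theorem Pmat_pow_self : Pmat p ^ p = 1 := by
  rw [Pmat_pow, ← Matrix.diagonal_one]
  congr 1
  ext i
  simp [omega_pow_eq_stdAddChar]

theorem Qmat_pow_self : Qmat p ^ p = 1 := by
  ext i j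
  simp only [Qmat_pow_apply, Nat.add_mod_right, Nat.mod_eq_of_lt i.isLt, Matrix.one_apply,
    Fin.ext_iff, eq_comm]

theorem Qmat_mul_Pmat : Qmat p * Pmat p = ω p • (Pmat p * Qmat p) := by
  ext i j
  simp only [Pmat, Qmat, Matrix.mul_diagonal, Matrix.smul_apply, Matrix.diagonal_mul,
    Matrix.of_apply, smul_eq_mul]
  split_ifs with h
  · rw [h, mul_one, one_mul, ← pow_succ', omega_pow_eq_stdAddChar, omega_pow_eq_stdAddChar]
    simp
  · simp

theorem Qmat_pow_mul_Pmat_pow (j k : ℕ) :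
    Qmat p ^ j * Pmat p ^ k = ω p ^ (j * k) • (Pmat p ^ k * Qmat p ^ j) := by
  have h1 : ∀ k, Qmat p * Pmat p ^ k = ω p ^ k • (Pmat p ^ k * Qmat p) := by
    intro k
    induction k with
    | zero => simp
    | succ k ih =>
      rw [pow_succ, ← mul_assoc, ih, smul_mul_assoc, mul_assoc, Qmat_mul_Pmat, mul_smul_comm,
        smul_smul, mul_assoc, ← pow_succ]
  induction j with
  | zero => simp
  | succ j ih =>
    rw [pow_succ, mul_assoc, h1, mul_smul_comm, ← mul_assoc, ih, smul_mul_assoc, smul_smul,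
      mul_assoc, ← pow_succ, ← pow_add]
    congr 2
    ring

theorem weylNat_mul (i j k l i' j' k' l' : ℕ) :
    weylNat p i j k l * weylNat p i' j' k' l' =
      ω p ^ (j * i' + l * k') • weylNat p (i + i') (j + j') (k + k') (l + l') := by
  have h : ∀ a b c d : ℕ, (Pmat p ^ a * Qmat p ^ b) * (Pmat p ^ c * Qmat p ^ d) =
      ω p ^ (b * c) • (Pmat p ^ (a + c) * Qmat p ^ (b + d)) := by
    intro a b c d
    rw [mul_assoc, ← mul_assoc (Qmat p ^ b), Qmat_pow_mul_Pmat_pow, smul_mul_assoc,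
      mul_smul_comm, pow_add, pow_add]
    simp only [mul_assoc]
  rw [weylNat, weylNat, ← Matrix.mul_kronecker_mul, h, h, Matrix.smul_kronecker,
    Matrix.kronecker_smul, smul_smul, ← pow_add, weylNat]

theorem weylNat_eq_weyl (i j k l : ℕ) :
    weylNat p i j k l = weyl ![(i : ZMod p), (j : ZMod p), (k : ZMod p), (l : ZMod p)] := by
  have hP : ∀ a, Pmat p ^ (a % p) = Pmat p ^ a := fun a =>
    (pow_eq_pow_mod a Pmat_pow_self).symm
  have hQ : ∀ a, Qmat p ^ (a % p) = Qmat p ^ a := fun a =>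
    (pow_eq_pow_mod a Qmat_pow_self).symm
  simp [weyl, weylNat, ZMod.val_natCast, hP, hQ]

theorem weyl_mul (v u : Fin 4 → ZMod p) :
    weyl v * weyl u = ZMod.stdAddChar (v 1 * u 0 + v 3 * u 2) • weyl (v + u) := by
  rw [weyl, weyl, weylNat_mul, omega_pow_eq_stdAddChar, weylNat_eq_weyl]
  have : ![(((v 0).val + (u 0).val : ℕ) : ZMod p), (((v 1).val + (u 1).val : ℕ) : ZMod p),
      (((v 2).val + (u 2).val : ℕ) : ZMod p), (((v 3).val + (u 3).val : ℕ) : ZMod p)] = v + u := by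
    ext i
    fin_cases i <;> simp
  rw [this]
  simp

theorem weyl_zero : weyl (0 : Fin 4 → ZMod p) = 1 := by
  simp [weyl, weylNat]

/-- The symplectic form on `(ℤ/pℤ)⁴`. -/
def symplecticForm (v u : Fin 4 → ZMod p) : ZMod p := v ⬝ᵥ (J4 p *ᵥ u)

theorem symplecticForm_eq (v u : Fin 4 → ZMod p) :
    symplecticForm v u = v 0 * u 1 - v 1 * u 0 + v 2 * u 3 - v 3 * u 2 := by
  simp [symplecticForm, J4, dotProduct, Matrix.mulVec, Fin.sum_univ_four]
  ring

theorem weyl_comm (v u : Fin 4 → ZMod p) :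
    weyl v * weyl u = ZMod.stdAddChar (symplecticForm u v) • (weyl u * weyl v) := by
  rw [weyl_mul, weyl_mul, smul_smul, ← AddChar.map_add_eq_mul, add_comm u v, symplecticForm_eq]
  congr 2
  ring

theorem weyl_mul_weyl_neg (v : Fin 4 → ZMod p) :
    weyl v * (ZMod.stdAddChar (v 1 * v 0 + v 3 * v 2) • weyl (-v)) = 1 := by
  rw [mul_smul_comm, weyl_mul, smul_smul, ← AddChar.map_add_eq_mul, add_neg_cancel, weyl_zero]
  simp only [Pi.neg_apply, mul_neg]
  rw [← neg_add, add_neg_cancel, AddChar.map_zero_eq_one, one_smul]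

theorem isUnit_weyl (v : Fin 4 → ZMod p) : IsUnit (weyl v) :=
  IsUnit.of_mul_eq_one _ (weyl_mul_weyl_neg v)

theorem weyl_mem_unitary (v : Fin 4 → ZMod p) :
    weyl v ∈ unitary (Matrix (Fin p × Fin p) (Fin p × Fin p) ℂ) := by
  have hP : Pmat p ∈ unitary (Matrix (Fin p) (Fin p) ℂ) := by
    have : star (Pmat p) * Pmat p = 1 := by
      rw [Matrix.star_eq_conjTranspose, Pmat, Matrix.diagonal_conjTranspose,
        Matrix.diagonal_mul_diagonal, ← Matrix.diagonal_one]
      congr 1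
      ext i
      simp only [Pi.star_apply, star_pow, ← mul_pow, star_omega_mul, one_pow]
    exact ⟨this, mul_eq_one_comm.mp this⟩
  have hQ : Qmat p ∈ unitary (Matrix (Fin p) (Fin p) ℂ) := by
    have : Qmat p * star (Qmat p) = 1 := by
      ext i j
      rw [Matrix.mul_apply, Finset.sum_eq_single ⟨((i : ℕ) + 1) % p, Nat.mod_lt _ hp.out.pos⟩]
      · have : ((i : ℕ) + 1) % p = ((j : ℕ) + 1) % p ↔ i = j := by
          refine ⟨fun h => ?_, fun h => by rw [h]⟩
          have := Nat.ModEq.add_right_cancel' 1 h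
          exact Fin.ext (by simpa [Nat.ModEq, Nat.mod_eq_of_lt] using this)
        simp [Qmat, Matrix.star_apply, Matrix.one_apply, this, apply_ite]
      · intro b _ hb
        have : ¬ (b : ℕ) = ((i : ℕ) + 1) % p := fun h => hb (Fin.ext h)
        simp [Qmat, this]
      · simp
    exact ⟨mul_eq_one_comm.mp this, this⟩
  exact Matrix.kronecker_mem_unitary (mul_mem (pow_mem hP _) (pow_mem hQ _))
    (mul_mem (pow_mem hP _) (pow_mem hQ _))

theorem stdAddChar_eq_one_iff {a : ZMod p} : (ZMod.stdAddChar a : ℂ) = 1 ↔ a = 0 := by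
  rw [← AddChar.map_zero_eq_one (ZMod.stdAddChar (N := p)), ZMod.injective_stdAddChar.eq_iff]

theorem stdAddChar_ne_zero (a : ZMod p) : (ZMod.stdAddChar a : ℂ) ≠ 0 := by
  rw [ZMod.stdAddChar_apply]
  exact Circle.coe_ne_zero _

theorem symplecticForm_single (v : Fin 4 → ZMod p) :
    symplecticForm v (Pi.single 1 1) = v 0 ∧ symplecticForm v (Pi.single 0 1) = - v 1 ∧
      symplecticForm v (Pi.single 3 1) = v 2 ∧ symplecticForm v (Pi.single 2 1) = - v 3 := by
  simp [symplecticForm_eq]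

/-- The symplectic form is nondegenerate. -/
theorem eq_zero_of_symplecticForm {v : Fin 4 → ZMod p} (h : ∀ u, symplecticForm v u = 0) :
    v = 0 := by
  obtain ⟨h0, h1, h2, h3⟩ := symplecticForm_single v
  rw [h] at h0 h1 h2 h3
  ext i
  fin_cases i
  · exact h0.symm
  · simpa using h1.symm
  · exact h2.symm
  · simpa using h3.symm

theorem symplecticForm_swap (v u : Fin 4 → ZMod p) :
    symplecticForm v u = - symplecticForm u v := by
  rw [symplecticForm_eq, symplecticForm_eq]
  ring

theorem trace_weyl {v : Fin 4 → ZMod p} (hv : v ≠ 0) : (weyl v).trace = 0 := by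
  obtain ⟨u, hu⟩ : ∃ u, symplecticForm v u ≠ 0 := by
    by_contra! h
    exact hv (eq_zero_of_symplecticForm h)
  obtain ⟨b, hb⟩ := (isUnit_weyl u).exists_left_inv
  have h1 : (weyl v).trace = ZMod.stdAddChar (symplecticForm v u) * (weyl v).trace := by
    calc (weyl v).trace = (b * (weyl u * weyl v)).trace := by rw [← mul_assoc, hb, one_mul]
      _ = _ := by
        rw [weyl_comm, mul_smul_comm, Matrix.trace_smul, smul_eq_mul, Matrix.trace_mul_comm,
          mul_assoc, mul_eq_one_comm.mp hb, mul_one]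
  by_contra h
  exact hu (stdAddChar_eq_one_iff.mp (mul_right_cancel₀ h (by rw [← h1, one_mul])))

/-- A matrix commuting with the four generators of the Pauli group is scalar. -/
theorem exists_eq_smul_one_of_commute_weyl {Z : Matrix (Fin p × Fin p) (Fin p × Fin p) ℂ}
    (hZ : ∀ i : Fin 4, weyl (Pi.single i 1) * Z = Z * weyl (Pi.single i 1)) :
    ∃ c : ℂ, Z = c • (1 : Matrix (Fin p × Fin p) (Fin p × Fin p) ℂ) := by
  have hinj : ∀ a b : Fin p, ω p ^ (a : ℕ) = ω p ^ (b : ℕ) → a = b := by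
    intro a b h
    rw [omega_pow_eq_stdAddChar, omega_pow_eq_stdAddChar] at h
    have := congrArg ZMod.val (ZMod.injective_stdAddChar h)
    rw [ZMod.val_natCast_of_lt a.isLt, ZMod.val_natCast_of_lt b.isLt] at this
    exact Fin.ext this
  have w0 : weyl (Pi.single 0 1 : Fin 4 → ZMod p) = Pmat p ⊗ₖ 1 := by
    simp [weyl, weylNat, ZMod.val_one]
  have w1 : weyl (Pi.single 1 1 : Fin 4 → ZMod p) = Qmat p ⊗ₖ 1 := by
    simp [weyl, weylNat, ZMod.val_one]
  have w2 : weyl (Pi.single 2 1 : Fin 4 → ZMod p) = 1 ⊗ₖ Pmat p := by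
    simp [weyl, weylNat, ZMod.val_one]
  have w3 : weyl (Pi.single 3 1 : Fin 4 → ZMod p) = 1 ⊗ₖ Qmat p := by
    simp [weyl, weylNat, ZMod.val_one]
  have d0 : ∀ a b c d, Z (a, b) (c, d) ≠ 0 → a = c := by
    intro a b c d h
    have := congrFun (congrFun (hZ 0) (a, b)) (c, d)
    rw [w0, Pmat, ← Matrix.diagonal_one, Matrix.diagonal_kronecker_diagonal,
      Matrix.diagonal_mul, Matrix.mul_diagonal, mul_comm] at this
    simpa using hinj a c (by simpa using mul_left_cancel₀ h this)
  have d2 : ∀ a b c d, Z (a, b) (c, d) ≠ 0 → b = d := by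
    intro a b c d h
    have := congrFun (congrFun (hZ 2) (a, b)) (c, d)
    rw [w2, Pmat, ← Matrix.diagonal_one, Matrix.diagonal_kronecker_diagonal,
      Matrix.diagonal_mul, Matrix.mul_diagonal, mul_comm] at this
    simpa using hinj b d (by simpa using mul_left_cancel₀ h this)
  have c1 : ∀ (a b : Fin p) (h : (a : ℕ) + 1 < p),
      Z (⟨a + 1, h⟩, b) (⟨a + 1, h⟩, b) = Z (a, b) (a, b) := by
    intro a b h
    have := congrFun (congrFun (hZ 1) (a, b)) (⟨a + 1, h⟩, b)
    rw [w1, Matrix.mul_apply, Matrix.mul_apply, Finset.sum_eq_single (⟨a + 1, h⟩, b),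
      Finset.sum_eq_single (a, b)] at this
    · simpa [Qmat, Nat.mod_eq_of_lt h] using this
    · rintro ⟨c, d⟩ - hcd
      by_contra hne
      have hz := left_ne_zero_of_mul hne
      exact hcd (Prod.ext (d0 _ _ _ _ hz).symm (d2 _ _ _ _ hz).symm)
    · simp
    · rintro ⟨c, d⟩ - hcd
      by_contra hne
      have hz := right_ne_zero_of_mul hne
      exact hcd (Prod.ext (d0 _ _ _ _ hz) (d2 _ _ _ _ hz))
    · simp
  have c3 : ∀ (a b : Fin p) (h : (b : ℕ) + 1 < p),
      Z (a, ⟨b + 1, h⟩) (a, ⟨b + 1, h⟩) = Z (a, b) (a, b) := by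
    intro a b h
    have := congrFun (congrFun (hZ 3) (a, b)) (a, ⟨b + 1, h⟩)
    rw [w3, Matrix.mul_apply, Matrix.mul_apply, Finset.sum_eq_single (a, ⟨b + 1, h⟩),
      Finset.sum_eq_single (a, b)] at this
    · simpa [Qmat, Nat.mod_eq_of_lt h] using this
    · rintro ⟨c, d⟩ - hcd
      by_contra hne
      have hz := left_ne_zero_of_mul hne
      exact hcd (Prod.ext (d0 _ _ _ _ hz).symm (d2 _ _ _ _ hz).symm)
    · simp
    · rintro ⟨c, d⟩ - hcd
      by_contra hne
      have hz := right_ne_zero_of_mul hne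
      exact hcd (Prod.ext (d0 _ _ _ _ hz) (d2 _ _ _ _ hz))
    · simp
  let o : Fin p := ⟨0, hp.out.pos⟩
  have e1 : ∀ (a : ℕ) (h : a < p) (b : Fin p), Z (⟨a, h⟩, b) (⟨a, h⟩, b) = Z (o, b) (o, b) := by
    intro a
    induction a with
    | zero => intros; rfl
    | succ a ih => intro h b; rw [← ih (by omega) b]; exact c1 ⟨a, by omega⟩ b h
  have e3 : ∀ (b : ℕ) (h : b < p), Z (o, ⟨b, h⟩) (o, ⟨b, h⟩) = Z (o, o) (o, o) := by
    intro b
    induction b with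
    | zero => intros; rfl
    | succ b ih => intro h; rw [← ih (by omega)]; exact c3 o ⟨b, by omega⟩ h
  refine ⟨Z (o, o) (o, o), ?_⟩
  ext ⟨a, b⟩ ⟨c, d⟩
  by_cases h : (a, b) = (c, d)
  · rw [← h, e1 a a.isLt b, e3 b b.isLt]
    simp
  · rw [Matrix.smul_apply, Matrix.one_apply_ne h, smul_zero]
    by_contra hz
    exact h (Prod.ext (d0 _ _ _ _ hz) (d2 _ _ _ _ hz))

end Pauli

section Adjoint

variable {p : ℕ} [hp : Fact p.Prime]

local notation "Mat" p => Matrix (Fin p × Fin p) (Fin p × Fin p) ℂ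

omit hp in
theorem exists_actsAsAd {M : Mat p} (hM : IsUnit M) : ∃ φ : Aut p, actsAsAd M φ := by
  have hd : IsUnit M.det := (Matrix.isUnit_iff_isUnit_det M).mp hM
  have h1 : M * M⁻¹ = 1 := Matrix.mul_nonsing_inv _ hd
  have h2 : M⁻¹ * M = 1 := Matrix.nonsing_inv_mul _ hd
  have hc : ∀ A B : Mat p, M⁻¹ * A * M * (M⁻¹ * B * M) = M⁻¹ * (A * B) * M := by
    intro A B
    calc _ = M⁻¹ * A * (M * M⁻¹) * B * M := by simp only [mul_assoc]
      _ = _ := by simp only [h1, mul_one, mul_assoc]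
  have ht : ∀ X : slp p, Matrix.trace (X : Mat p) = 0 := fun X => X.2
  have ht1 : ∀ X : slp p, M⁻¹ * (X : Mat p) * M ∈ slp p := by
    intro X
    change Matrix.trace (M⁻¹ * (X : Mat p) * M) = 0
    rw [Matrix.trace_mul_comm, ← mul_assoc, h1, one_mul, ht]
  have ht2 : ∀ X : slp p, M * (X : Mat p) * M⁻¹ ∈ slp p := by
    intro X
    change Matrix.trace (M * (X : Mat p) * M⁻¹) = 0
    rw [Matrix.trace_mul_comm, ← mul_assoc, h2, one_mul, ht]
  have hl : ∀ A B : Mat p, M⁻¹ * (A * B - B * A) * M =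
      M⁻¹ * A * M * (M⁻¹ * B * M) - M⁻¹ * B * M * (M⁻¹ * A * M) := by
    intro A B
    rw [hc, hc, mul_sub, sub_mul]
  have ha : ∀ A B : Mat p, M⁻¹ * (A + B) * M = M⁻¹ * A * M + M⁻¹ * B * M := by
    intro A B
    rw [mul_add, add_mul]
  have hs : ∀ (c : ℂ) (A : Mat p), M⁻¹ * (c • A) * M = c • (M⁻¹ * A * M) := by
    intro c A
    rw [mul_smul_comm, smul_mul_assoc]
  have hi1 : ∀ A : Mat p, M * (M⁻¹ * A * M) * M⁻¹ = A := by
    intro A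
    rw [← mul_assoc, ← mul_assoc, h1, one_mul, mul_assoc, h1, mul_one]
  have hi2 : ∀ A : Mat p, M⁻¹ * (M * A * M⁻¹) * M = A := by
    intro A
    rw [← mul_assoc, ← mul_assoc, h2, one_mul, mul_assoc, h2, mul_one]
  exact ⟨
    { toFun := fun X => ⟨M⁻¹ * (X : Mat p) * M, ht1 X⟩
      invFun := fun X => ⟨M * (X : Mat p) * M⁻¹, ht2 X⟩
      map_add' := fun X Y => Subtype.ext (ha X Y)
      map_smul' := fun c X => Subtype.ext (hs c X)
      map_lie' := fun {X Y} => Subtype.ext (hl X Y)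
      left_inv := fun X => Subtype.ext (hi1 X)
      right_inv := fun X => Subtype.ext (hi2 X) }, fun X => rfl⟩

omit hp in
theorem actsAsAd_mul {M N : Mat p} {φ ψ : Aut p} (hφ : actsAsAd M φ) (hψ : actsAsAd N ψ) :
    actsAsAd (N * M) (φ * ψ) := by
  intro X
  change ((φ (ψ X) : slp p) : Mat p) = _
  rw [hφ, hψ, Matrix.mul_inv_rev]
  simp only [mul_assoc]

omit hp in
theorem actsAsAd_inv {M : Mat p} (hM : IsUnit M) {φ : Aut p} (hφ : actsAsAd M φ) :
    actsAsAd M⁻¹ φ⁻¹ := by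
  have hd : IsUnit M.det := (Matrix.isUnit_iff_isUnit_det M).mp hM
  intro X
  have h := hφ (φ⁻¹ X)
  have h1 : φ (φ⁻¹ X) = X := φ.apply_symm_apply X
  rw [h1] at h
  rw [h, Matrix.nonsing_inv_nonsing_inv _ hd]
  simp only [mul_assoc, Matrix.mul_nonsing_inv _ hd, mul_one]
  rw [← mul_assoc, Matrix.mul_nonsing_inv _ hd, one_mul]

omit hp in
theorem actsAsAd_smul_iff {M : Mat p} {c : ℂ} (hc : c ≠ 0) {φ : Aut p} :
    actsAsAd (c • M) φ ↔ actsAsAd M φ := by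
  have hinv : (c • M)⁻¹ = c⁻¹ • M⁻¹ := by
    by_cases hM : IsUnit M.det
    · apply Matrix.inv_eq_left_inv
      rw [smul_mul_smul_comm, inv_mul_cancel₀ hc, Matrix.nonsing_inv_mul _ hM, one_smul]
    · rw [Matrix.nonsing_inv_apply_not_isUnit _ hM, smul_zero, Matrix.nonsing_inv_apply_not_isUnit]
      rw [Matrix.det_smul]
      intro h
      exact hM (isUnit_of_mul_isUnit_right h)
  simp only [actsAsAd, hinv, smul_mul_assoc, mul_smul_comm, smul_smul, mul_inv_cancel₀ hc, one_smul]

omit hp in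
theorem actsAsAd_unique {M : Mat p} {φ ψ : Aut p} (hφ : actsAsAd M φ) (hψ : actsAsAd M ψ) :
    φ = ψ :=
  LieEquiv.ext fun X => Subtype.ext ((hφ X).trans (hψ X).symm)

/-- Two invertible matrices inducing the same automorphism are proportional. -/
theorem exists_eq_smul_of_actsAsAd {M N : Mat p} (hM : IsUnit M) (hN : IsUnit N) {φ : Aut p}
    (hφM : actsAsAd M φ) (hφN : actsAsAd N φ) : ∃ c : ℂ, c ≠ 0 ∧ M = c • N := by
  have hMd : IsUnit M.det := (Matrix.isUnit_iff_isUnit_det M).mp hM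
  have hNd : IsUnit N.det := (Matrix.isUnit_iff_isUnit_det N).mp hN
  obtain ⟨c, hc⟩ := exists_eq_smul_one_of_commute_weyl (Z := M * N⁻¹) (fun i => by
    have ht : weyl (Pi.single i 1 : Fin 4 → ZMod p) ∈ slp p :=
      LinearMap.mem_ker.2 (trace_weyl (by simp))
    have h := (hφM ⟨_, ht⟩).symm.trans (hφN ⟨_, ht⟩)
    simp only at h
    generalize weyl (Pi.single i 1 : Fin 4 → ZMod p) = W at h
    calc W * (M * N⁻¹) = M * (M⁻¹ * W * M) * N⁻¹ := by
          simp only [← mul_assoc, Matrix.mul_nonsing_inv _ hMd, one_mul]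
      _ = M * N⁻¹ * W := by
          rw [h]
          simp only [mul_assoc, Matrix.mul_nonsing_inv _ hNd, mul_one])
  have h : M = c • N := by
    calc M = M * N⁻¹ * N := by rw [mul_assoc, Matrix.nonsing_inv_mul _ hNd, mul_one]
      _ = _ := by rw [hc, smul_mul_assoc, one_mul]
  refine ⟨c, ?_, h⟩
  rintro rfl
  rw [zero_smul] at h
  have : Nonempty (Fin p × Fin p) := ⟨⟨0, hp.out.pos⟩, ⟨0, hp.out.pos⟩⟩
  exact not_isUnit_zero (h ▸ hM)

/-- The inner automorphism induced by a Weyl operator. -/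
def adWeyl (v : Fin 4 → ZMod p) : Aut p := (exists_actsAsAd (isUnit_weyl v)).choose

theorem actsAsAd_adWeyl (v : Fin 4 → ZMod p) : actsAsAd (weyl v) (adWeyl v) :=
  (exists_actsAsAd (isUnit_weyl v)).choose_spec

theorem adWeyl_add (v u : Fin 4 → ZMod p) : adWeyl (v + u) = adWeyl v * adWeyl u := by
  have h := actsAsAd_mul (actsAsAd_adWeyl v) (actsAsAd_adWeyl u)
  rw [weyl_mul, actsAsAd_smul_iff (stdAddChar_ne_zero _), add_comm] at h
  exact actsAsAd_unique (actsAsAd_adWeyl _) h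

/-- The map `v ↦ Ad_{W(v)}` as a homomorphism. -/
def adWeylHom (p : ℕ) [Fact p.Prime] : Multiplicative (Fin 4 → ZMod p) →* Aut p :=
  MonoidHom.mk' (fun v => adWeyl v.toAdd) fun v u => adWeyl_add v.toAdd u.toAdd

theorem adWeyl_zero : adWeyl (0 : Fin 4 → ZMod p) = 1 := (adWeylHom p).map_one

theorem adWeyl_neg (v : Fin 4 → ZMod p) : adWeyl (-v) = (adWeyl v)⁻¹ :=
  (adWeylHom p).map_inv (Multiplicative.ofAdd v)

theorem eq_of_smul_weyl_eq {v : Fin 4 → ZMod p} {a b : ℂ} (h : a • weyl v = b • weyl v) :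
    a = b := by
  have : Nonempty (Fin p × Fin p) := ⟨⟨0, hp.out.pos⟩, ⟨0, hp.out.pos⟩⟩
  exact smul_left_injective ℂ (isUnit_weyl v).ne_zero h

theorem adWeyl_injective : Function.Injective (adWeyl : (Fin 4 → ZMod p) → Aut p) := by
  intro v u h
  obtain ⟨c, hc, hvu⟩ := exists_eq_smul_of_actsAsAd (isUnit_weyl v) (isUnit_weyl u)
    (actsAsAd_adWeyl v) (h ▸ actsAsAd_adWeyl u)
  have key : ∀ w, symplecticForm v w = symplecticForm u w := by
    intro w
    have h1 := weyl_comm w v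
    have h2 := weyl_comm w u
    rw [hvu, smul_mul_assoc, mul_smul_comm, h2, smul_smul, smul_smul, weyl_mul, smul_smul,
      smul_smul] at h1
    have h3 := eq_of_smul_weyl_eq h1
    have h4 := mul_right_cancel₀ (stdAddChar_ne_zero _) h3
    rw [mul_comm] at h4
    exact (ZMod.injective_stdAddChar (mul_right_cancel₀ hc h4)).symm
  rw [← sub_eq_zero]
  apply eq_zero_of_symplecticForm
  intro w
  have := key w
  rw [symplecticForm, sub_dotProduct]
  exact sub_eq_zero.mpr this

theorem mem_Gset_iff {φ : Aut p} : φ ∈ Gset p ↔ ∃ v : Fin 4 → ZMod p, φ = adWeyl v := by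
  constructor
  · rintro ⟨i, j, k, l, h⟩
    change actsAsAd (weylNat p i j k l) φ at h
    rw [weylNat_eq_weyl] at h
    exact ⟨_, actsAsAd_unique h (actsAsAd_adWeyl _)⟩
  · rintro ⟨v, rfl⟩
    exact ⟨_, _, _, _, actsAsAd_adWeyl v⟩

end Adjoint

theorem exists_common_eigenvector {K V ι : Type*} [Field K] [IsAlgClosed K] [AddCommGroup V]
    [Module K V] [FiniteDimensional K V] [Nontrivial V] (f : ι → Module.End K V)
    (hf : ∀ i j, Commute (f i) (f j)) (s : Finset ι) :
    ∃ x : V, x ≠ 0 ∧ ∀ i ∈ s, ∃ μ : K, f i x = μ • x := by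
  classical
  induction s using Finset.induction_on with
  | empty =>
    obtain ⟨x, hx⟩ := exists_ne (0 : V)
    exact ⟨x, hx, by simp⟩
  | insert a s _ ih =>
    obtain ⟨x, hx, hμ⟩ := ih
    choose! μ hμ using hμ
    let E : Submodule K V := ⨅ i ∈ s, LinearMap.ker (f i - algebraMap K (Module.End K V) (μ i))
    have hE : ∀ y, y ∈ E ↔ ∀ i ∈ s, f i y = μ i • y := by
      intro y
      simp [E, Submodule.mem_iInf, sub_eq_zero]
    have hmaps : ∀ y ∈ E, f a y ∈ E := by
      intro y hy
      rw [hE] at hy ⊢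
      intro i hi
      have := LinearMap.congr_fun (hf i a) y
      simp only [Module.End.mul_apply] at this
      rw [this, hy i hi, map_smul]
    have : Nontrivial E := ⟨⟨x, (hE x).2 hμ⟩, 0, fun h => hx (congrArg Subtype.val h)⟩
    obtain ⟨c, hc⟩ := Module.End.exists_eigenvalue ((f a).restrict hmaps)
    obtain ⟨y, hy⟩ := hc.exists_hasEigenvector
    refine ⟨y, fun h => hy.2 (Subtype.ext h), fun i hi => ?_⟩
    rcases Finset.mem_insert.mp hi with rfl | hi
    · exact ⟨c, congrArg Subtype.val hy.apply_eq_smul⟩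
    · exact ⟨μ i, (hE y).1 y.2 i hi⟩

section Normalizer

variable {p : ℕ} [hp : Fact p.Prime]

local notation "Mat" p => Matrix (Fin p × Fin p) (Fin p × Fin p) ℂ

/-- `φ` conjugates the inner automorphism of `W(v)` to that of `W(Xv)`. -/
def Intertwines (φ : Aut p) (X : Matrix (Fin 4) (Fin 4) (ZMod p)) : Prop :=
  ∀ v, φ * adWeyl v = adWeyl (X *ᵥ v) * φ

theorem Intertwines.unique {φ : Aut p} {X Y : Matrix (Fin 4) (Fin 4) (ZMod p)}
    (hX : Intertwines φ X) (hY : Intertwines φ Y) : X = Y := by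
  apply Matrix.ext_of_mulVec_single
  intro i
  exact adWeyl_injective (mul_right_cancel ((hX _).symm.trans (hY _)))

theorem Intertwines.mul {φ ψ : Aut p} {X Y : Matrix (Fin 4) (Fin 4) (ZMod p)}
    (hX : Intertwines φ X) (hY : Intertwines ψ Y) : Intertwines (φ * ψ) (X * Y) := by
  intro v
  rw [mul_assoc, hY, ← mul_assoc, hX, Matrix.mulVec_mulVec, mul_assoc]

theorem Intertwines.inv {φ : Aut p} {X Y : Matrix (Fin 4) (Fin 4) (ZMod p)}
    (hX : Intertwines φ X) (hXY : X * Y = 1) : Intertwines φ⁻¹ Y := by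
  intro v
  have h := hX (Y *ᵥ v)
  rw [Matrix.mulVec_mulVec, hXY, Matrix.one_mulVec] at h
  rw [inv_mul_eq_iff_eq_mul, ← mul_assoc, h, mul_inv_cancel_right]

theorem Intertwines.adWeyl_mul {φ : Aut p} {X : Matrix (Fin 4) (Fin 4) (ZMod p)}
    (hX : Intertwines φ X) (v : Fin 4 → ZMod p) : Intertwines (adWeyl v * φ) X := by
  intro u
  rw [mul_assoc, hX, ← mul_assoc, ← mul_assoc, ← adWeyl_add, ← adWeyl_add, add_comm]

theorem Intertwines.mem_Nset {φ : Aut p} {X : Matrix (Fin 4) (Fin 4) (ZMod p)}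
    (hX : Intertwines φ X) : φ ∈ Nset p := by
  intro h hh
  obtain ⟨v, rfl⟩ := mem_Gset_iff.mp hh
  exact mem_Gset_iff.mpr ⟨X *ᵥ v, mul_inv_eq_iff_eq_mul.mpr (hX v)⟩

theorem exists_intertwines_of_mem_Nset {φ : Aut p} (hφ : φ ∈ Nset p) :
    ∃ X, Intertwines φ X := by
  have h : ∀ v, ∃ w, φ * adWeyl v = adWeyl w * φ := fun v => by
    obtain ⟨w, hw⟩ := mem_Gset_iff.mp (hφ _ (mem_Gset_iff.mpr ⟨v, rfl⟩))
    exact ⟨w, mul_inv_eq_iff_eq_mul.mp hw⟩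
  choose f hf using h
  have hadd : ∀ v w, f (v + w) = f v + f w := by
    intro v w
    apply adWeyl_injective
    apply mul_right_cancel (b := φ)
    rw [← hf, adWeyl_add, adWeyl_add, ← mul_assoc, hf, mul_assoc, hf, mul_assoc]
  let L := (AddMonoidHom.mk' f hadd).toZModLinearMap p
  refine ⟨LinearMap.toMatrix' L, fun v => ?_⟩
  rw [← Matrix.toLin'_apply, Matrix.toLin'_toMatrix']
  exact hf v

theorem Intertwines.exists_weyl_mul {φ : Aut p} {X : Matrix (Fin 4) (Fin 4) (ZMod p)}
    (hX : Intertwines φ X) {M : Mat p} (hM : IsUnit M) (hφ : actsAsAd M φ)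
    (v : Fin 4 → ZMod p) : ∃ c : ℂ, c ≠ 0 ∧ weyl v * M = c • (M * weyl (X *ᵥ v)) :=
  exists_eq_smul_of_actsAsAd ((isUnit_weyl v).mul hM) (hM.mul (isUnit_weyl _))
    (actsAsAd_mul hφ (actsAsAd_adWeyl v)) (hX v ▸ actsAsAd_mul (actsAsAd_adWeyl _) hφ)

omit hp in
theorem IsInnerAut.exists_isUnit {φ : Aut p} (h : IsInnerAut φ) :
    ∃ M : Mat p, IsUnit M ∧ actsAsAd M φ := by
  obtain ⟨M, hM, h⟩ := h
  exact ⟨M, (Matrix.isUnit_iff_isUnit_det M).mpr hM, h⟩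

theorem symplecticForm_mulVec_iff {X : Matrix (Fin 4) (Fin 4) (ZMod p)} :
    (∀ v u, symplecticForm (X *ᵥ v) (X *ᵥ u) = symplecticForm v u) ↔
      Xᵀ * J4 p * X = J4 p := by
  have h : ∀ v u, symplecticForm (X *ᵥ v) (X *ᵥ u) = v ⬝ᵥ ((Xᵀ * J4 p * X) *ᵥ u) := by
    intro v u
    rw [symplecticForm, ← Matrix.mulVec_mulVec, ← Matrix.mulVec_mulVec, Matrix.dotProduct_mulVec v,
      Matrix.vecMul_transpose]
  simp only [h]
  refine ⟨fun hX => ?_, fun hX v u => by rw [hX]; rfl⟩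
  ext i j
  simpa [symplecticForm] using hX (Pi.single i 1) (Pi.single j 1)

theorem Intertwines.symplectic {φ : Aut p} {X : Matrix (Fin 4) (Fin 4) (ZMod p)}
    (hX : Intertwines φ X) (hφ : IsInnerAut φ) : Xᵀ * J4 p * X = J4 p := by
  obtain ⟨M, hM, hφ⟩ := hφ.exists_isUnit
  rw [← symplecticForm_mulVec_iff]
  intro v u
  obtain ⟨c, hc, h1⟩ := hX.exists_weyl_mul hM hφ u
  obtain ⟨d, hd, h2⟩ := hX.exists_weyl_mul hM hφ v
  have h3 : weyl u * weyl v * M = (c * d) • (M * (weyl (X *ᵥ u) * weyl (X *ᵥ v))) := by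
    rw [mul_assoc, h2, mul_smul_comm, ← mul_assoc, h1, smul_mul_assoc, smul_smul, mul_comm d,
      mul_assoc]
  have h4 : weyl v * weyl u * M = (c * d) • (M * (weyl (X *ᵥ v) * weyl (X *ᵥ u))) := by
    rw [mul_assoc, h1, mul_smul_comm, ← mul_assoc, h2, smul_mul_assoc, smul_smul, mul_assoc]
  rw [weyl_comm, smul_mul_assoc, h4, weyl_comm (X *ᵥ u), mul_smul_comm, smul_smul, smul_smul,
    mul_comm (c * d)] at h3
  have : Nonempty (Fin p × Fin p) := ⟨⟨0, hp.out.pos⟩, ⟨0, hp.out.pos⟩⟩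
  have h5 := smul_left_injective ℂ
    (hM.mul ((isUnit_weyl (X *ᵥ v)).mul (isUnit_weyl (X *ᵥ u)))).ne_zero h3
  exact (ZMod.injective_stdAddChar (mul_right_cancel₀ (mul_ne_zero hc hd) h5)).symm

theorem exists_weyl_pow_eq_smul (v : Fin 4 → ZMod p) (k : ℕ) :
    ∃ s : ℂ, weyl v ^ k = s • weyl (k • v) := by
  induction k with
  | zero => exact ⟨1, by simp [weyl_zero]⟩
  | succ k ih =>
    obtain ⟨s, hs⟩ := ih
    exact ⟨_, by rw [pow_succ, hs, smul_mul_assoc, weyl_mul, smul_smul, succ_nsmul]⟩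

theorem pow_eq_one_of_weyl_mul {M : Mat p} (hM : IsUnit M) {v : Fin 4 → ZMod p} {c : ℂ}
    (h : weyl v * M = c • (M * weyl v)) : c ^ p = 1 := by
  have : Nonempty (Fin p × Fin p) := ⟨⟨0, hp.out.pos⟩, ⟨0, hp.out.pos⟩⟩
  have hpow : ∀ k, weyl v ^ k * M = c ^ k • (M * weyl v ^ k) := by
    intro k
    induction k with
    | zero => simp
    | succ k ih =>
      rw [pow_succ, mul_assoc, h, mul_smul_comm, ← mul_assoc, ih, smul_mul_assoc, smul_smul,
        mul_assoc, ← pow_succ, ← pow_succ']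
  obtain ⟨s, hs⟩ := exists_weyl_pow_eq_smul v p
  have hz : p • v = 0 := by
    ext i
    simp
  rw [hz, weyl_zero] at hs
  have hs0 : s ≠ 0 := by
    rintro rfl
    rw [zero_smul] at hs
    exact ((isUnit_weyl v).pow p).ne_zero hs
  have h1 := hpow p
  rw [hs, smul_mul_assoc, one_mul, mul_smul_comm, mul_one, smul_smul] at h1
  exact mul_right_cancel₀ hs0 ((smul_left_injective ℂ hM.ne_zero h1).symm.trans (one_mul s).symm)

theorem Intertwines.mem_Gset_of_one {φ : Aut p} (hX : Intertwines φ 1) (hφ : IsInnerAut φ) :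
    φ ∈ Gset p := by
  have : Nonempty (Fin p × Fin p) := ⟨⟨0, hp.out.pos⟩, ⟨0, hp.out.pos⟩⟩
  obtain ⟨M, hM, hφ⟩ := hφ.exists_isUnit
  have h : ∀ i : Fin 4, ∃ a : ZMod p, weyl (Pi.single i 1) * M =
      (ZMod.stdAddChar a : ℂ) • (M * weyl (Pi.single i 1)) := by
    intro i
    obtain ⟨c, -, hc⟩ := hX.exists_weyl_mul hM hφ (Pi.single i 1)
    rw [Matrix.one_mulVec] at hc
    have hprim : IsPrimitiveRoot (ω p) p := Complex.isPrimitiveRoot_exp p hp.out.ne_zero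
    obtain ⟨m, -, hm⟩ := hprim.eq_pow_of_pow_eq_one (pow_eq_one_of_weyl_mul hM hc)
    exact ⟨m, by rw [← omega_pow_eq_stdAddChar, hm, hc]⟩
  choose a ha using h
  let u : Fin 4 → ZMod p := ![-a 1, a 0, -a 3, a 2]
  have hu : ∀ i, a i + symplecticForm u (Pi.single i 1) = 0 := by
    intro i
    fin_cases i <;> simp [symplecticForm_eq, u]
  obtain ⟨c, hc⟩ := exists_eq_smul_one_of_commute_weyl (Z := M * weyl u) fun i => by
    rw [← mul_assoc, ha, smul_mul_assoc, mul_assoc, weyl_comm, mul_smul_comm, smul_smul,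
      ← AddChar.map_add_eq_mul, hu, AddChar.map_zero_eq_one, one_smul, mul_assoc]
  have hc0 : c ≠ 0 := by
    rintro rfl
    rw [zero_smul] at hc
    exact (hM.mul (isUnit_weyl u)).ne_zero hc
  have h1 : actsAsAd (M * weyl u) (adWeyl u * φ) := actsAsAd_mul (actsAsAd_adWeyl u) hφ
  rw [hc, actsAsAd_smul_iff hc0, ← weyl_zero] at h1
  have h2 := actsAsAd_unique h1 (actsAsAd_adWeyl 0)
  rw [adWeyl_zero] at h2
  exact mem_Gset_iff.mpr ⟨-u, by rw [adWeyl_neg]; exact eq_inv_of_mul_eq_one_right h2⟩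

open scoped ComplexOrder in
theorem commute_mul_conjTranspose_of_mul_eq_smul {n : Type*} [Fintype n] [DecidableEq n]
    {A B Y : Matrix n n ℂ} (hA : A ∈ unitary (Matrix n n ℂ)) (hB : B ∈ unitary (Matrix n n ℂ))
    (hY : Y ≠ 0) {c : ℂ} (h : B * Y = c • (Y * A)) :
    c ≠ 0 ∧ B * (Y * Yᴴ) = Y * Yᴴ * B := by
  have hA2 : A * Aᴴ = 1 := hA.2
  have hB1 : Bᴴ * B = 1 := hB.1
  have h1 : B * (Y * Yᴴ) * Bᴴ = (c * star c) • (Y * Yᴴ) := by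
    calc B * (Y * Yᴴ) * Bᴴ = (B * Y) * (B * Y)ᴴ := by
          rw [Matrix.conjTranspose_mul]; simp only [mul_assoc]
      _ = (c * star c) • (Y * (A * Aᴴ) * Yᴴ) := by
          rw [h, Matrix.conjTranspose_smul, Matrix.conjTranspose_mul, smul_mul_smul_comm]
          simp only [mul_assoc]
      _ = _ := by rw [hA2, mul_one]
  have ht : (Y * Yᴴ).trace ≠ 0 := by
    rwa [Ne, Matrix.trace_mul_conjTranspose_self_eq_zero_iff]
  have h2 := congrArg Matrix.trace h1
  rw [Matrix.trace_mul_comm, ← mul_assoc, hB1, one_mul, Matrix.trace_smul, smul_eq_mul] at h2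
  have h3 : c * star c = 1 := mul_right_cancel₀ ht (h2.symm.trans (one_mul _).symm)
  refine ⟨left_ne_zero_of_mul (h3 ▸ one_ne_zero), ?_⟩
  rw [h3, one_smul] at h1
  calc B * (Y * Yᴴ) = B * (Y * Yᴴ) * (Bᴴ * B) := by rw [hB1, mul_one]
    _ = _ := by rw [← mul_assoc, h1]

open scoped ComplexOrder in
/-- Every symplectic matrix is realized by an inner automorphism. -/
theorem exists_intertwines_of_symplectic {X : Matrix (Fin 4) (Fin 4) (ZMod p)}
    (hX : Xᵀ * J4 p * X = J4 p) : ∃ φ : Aut p, IsInnerAut φ ∧ Intertwines φ X := by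
  rw [← symplecticForm_mulVec_iff] at hX
  have : Nonempty (Fin p × Fin p) := ⟨⟨0, hp.out.pos⟩, ⟨0, hp.out.pos⟩⟩
  let S : (Fin 4 → ZMod p) → Module.End ℂ (Mat p) := fun v =>
    LinearMap.mulLeft ℂ (weyl v) * LinearMap.mulRight ℂ (weyl (-(X *ᵥ v)))
  have hS : ∀ v Y, S v Y = weyl v * Y * weyl (-(X *ᵥ v)) := fun v Y => by
    simp [S, mul_assoc]
  have hcomm : ∀ v u, Commute (S v) (S u) := by
    intro v u
    refine LinearMap.ext fun Y => ?_
    have hneg : symplecticForm (-(X *ᵥ v)) (-(X *ᵥ u)) = symplecticForm v u := by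
      rw [← hX v u, symplecticForm_eq, symplecticForm_eq]
      simp
    calc (S v * S u) Y
        = weyl v * weyl u * Y * (weyl (-(X *ᵥ u)) * weyl (-(X *ᵥ v))) := by
          rw [Module.End.mul_apply, hS, hS]; simp only [mul_assoc]
      _ = weyl u * weyl v * Y * (weyl (-(X *ᵥ v)) * weyl (-(X *ᵥ u))) := by
          rw [weyl_comm v u, weyl_comm (-(X *ᵥ u)), smul_mul_assoc, smul_mul_assoc,
            mul_smul_comm, smul_smul, hneg, ← AddChar.map_add_eq_mul, symplecticForm_swap u v,
            neg_add_cancel, AddChar.map_zero_eq_one, one_smul]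
      _ = (S u * S v) Y := by
          rw [Module.End.mul_apply, hS, hS]; simp only [mul_assoc]
  obtain ⟨Y, hY, hμ⟩ := exists_common_eigenvector S hcomm Finset.univ
  have hc : ∀ v, ∃ c : ℂ, weyl v * Y = c • (Y * weyl (X *ᵥ v)) := by
    intro v
    obtain ⟨μ, hμ⟩ := hμ v (Finset.mem_univ v)
    obtain ⟨a, ha⟩ : ∃ a : ℂ, weyl (-(X *ᵥ v)) * (a • weyl (X *ᵥ v)) = 1 := by
      have hw := weyl_mul_weyl_neg (-(X *ᵥ v))
      rw [neg_neg] at hw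
      exact ⟨_, hw⟩
    refine ⟨a * μ, ?_⟩
    rw [← mul_one (weyl v * Y), ← ha, ← mul_assoc, ← hS, hμ, mul_smul_comm, smul_mul_assoc,
      smul_smul]
  have hcY : ∀ v, ∃ c : ℂ, weyl v * Y = c • (Y * weyl (X *ᵥ v)) ∧ c ≠ 0 ∧
      weyl v * (Y * Yᴴ) = Y * Yᴴ * weyl v := fun v => by
    obtain ⟨c, hc⟩ := hc v
    exact ⟨c, hc, commute_mul_conjTranspose_of_mul_eq_smul (weyl_mem_unitary _)
      (weyl_mem_unitary v) hY hc⟩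
  obtain ⟨c, hc⟩ := exists_eq_smul_one_of_commute_weyl (Z := Y * Yᴴ) fun i =>
    (hcY (Pi.single i 1)).choose_spec.2.2
  have hc0 : c ≠ 0 := by
    rintro rfl
    rw [zero_smul, Matrix.self_mul_conjTranspose_eq_zero] at hc
    exact hY hc
  have hYu : IsUnit Y := IsUnit.of_mul_eq_one (c⁻¹ • Yᴴ) (by
    rw [mul_smul_comm, hc, smul_smul, inv_mul_cancel₀ hc0, one_smul])
  obtain ⟨φ, hφ⟩ := exists_actsAsAd hYu
  refine ⟨φ, ⟨Y, (Matrix.isUnit_iff_isUnit_det Y).mp hYu, hφ⟩, fun v => ?_⟩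
  obtain ⟨d, hd, hd0, -⟩ := hcY v
  have h1 := actsAsAd_mul hφ (actsAsAd_adWeyl v)
  rw [hd, actsAsAd_smul_iff hd0] at h1
  exact actsAsAd_unique h1 (actsAsAd_mul (actsAsAd_adWeyl _) hφ)

omit hp in
theorem IsInnerAut.mul {φ ψ : Aut p} (hφ : IsInnerAut φ) (hψ : IsInnerAut ψ) :
    IsInnerAut (φ * ψ) := by
  obtain ⟨M, hM, hφ⟩ := hφ
  obtain ⟨N, hN, hψ⟩ := hψ
  exact ⟨N * M, by rw [Matrix.det_mul]; exact hN.mul hM, actsAsAd_mul hφ hψ⟩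

omit hp in
theorem IsInnerAut.inv {φ : Aut p} (hφ : IsInnerAut φ) : IsInnerAut φ⁻¹ := by
  obtain ⟨M, hM, hφ⟩ := hφ
  exact ⟨M⁻¹, Matrix.isUnit_nonsing_inv_det M hM,
    actsAsAd_inv ((Matrix.isUnit_iff_isUnit_det M).mpr hM) hφ⟩

theorem exists_mul_eq_one_of_symplectic {X : Matrix (Fin 4) (Fin 4) (ZMod p)}
    (hX : Xᵀ * J4 p * X = J4 p) : ∃ Y, X * Y = 1 := by
  have hJ : J4 p * J4 p = -1 := by
    ext i j
    fin_cases i <;> fin_cases j <;> simp [J4, Matrix.mul_apply, Fin.sum_univ_four]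
  refine ⟨-(J4 p * (Xᵀ * J4 p)), mul_eq_one_comm.mp ?_⟩
  rw [neg_mul, mul_assoc, hX, hJ, neg_neg]

/-- The matrix over `ℤ/pℤ` describing the conjugation action of `φ` on the Pauli group. -/
def intertwiningMatrix (φ : Aut p) : Matrix (Fin 4) (Fin 4) (ZMod p) :=
  open scoped Classical in if h : ∃ X, Intertwines φ X then h.choose else 0

theorem Intertwines.intertwiningMatrix_eq {φ : Aut p} {X : Matrix (Fin 4) (Fin 4) (ZMod p)}
    (hX : Intertwines φ X) : intertwiningMatrix φ = X := by
  have h : ∃ X, Intertwines φ X := ⟨X, hX⟩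
  rw [intertwiningMatrix, dif_pos h]
  exact h.choose_spec.unique hX

end Normalizer

/-- For `p` prime, the quotient group `N_in(G)/G` is isomorphic to
`Sp(4, ℤ/pℤ)`.  This is expressed via a map `F` from automorphisms to `4×4` matrices over
`ℤ/pℤ` which, on `N_in(G)`, takes values in `Sp(4, ℤ/pℤ)`, is multiplicative, is surjective
onto `Sp(4, ℤ/pℤ)`, and whose fibres are exactly the cosets of `G`; moreover `N_in(G)` is
closed under multiplication and inversion (so that the quotient group makes sense). -/
theorem statement0 (p : ℕ) (hp : p.Prime) :
    (∀ φ ψ : Aut p, φ ∈ NinSet p → ψ ∈ NinSet p → φ * ψ ∈ NinSet p) ∧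
    (∀ φ : Aut p, φ ∈ NinSet p → φ⁻¹ ∈ NinSet p) ∧
    ∃ F : Aut p → Matrix (Fin 4) (Fin 4) (ZMod p),
      (∀ φ ∈ NinSet p, (F φ)ᵀ * J4 p * F φ = J4 p) ∧
      (∀ φ ψ : Aut p, φ ∈ NinSet p → ψ ∈ NinSet p → F (φ * ψ) = F φ * F ψ) ∧
      (∀ X : Matrix (Fin 4) (Fin 4) (ZMod p), Xᵀ * J4 p * X = J4 p →
        ∃ φ ∈ NinSet p, F φ = X) ∧
      (∀ φ ψ : Aut p, φ ∈ NinSet p → ψ ∈ NinSet p →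
        (F φ = F ψ ↔ ∃ h ∈ Gset p, φ = h * ψ)) := by
  have : Fact p.Prime := ⟨hp⟩
  have hint : ∀ φ ∈ NinSet p, Intertwines φ (intertwiningMatrix φ) := by
    intro φ hφ
    obtain ⟨X, hX⟩ := exists_intertwines_of_mem_Nset hφ.1
    rwa [hX.intertwiningMatrix_eq]
  have hsymp : ∀ φ ∈ NinSet p,
      (intertwiningMatrix φ)ᵀ * J4 p * intertwiningMatrix φ = J4 p :=
    fun φ hφ => (hint φ hφ).symplectic hφ.2
  refine ⟨fun φ ψ hφ hψ => ⟨((hint φ hφ).mul (hint ψ hψ)).mem_Nset, hφ.2.mul hψ.2⟩,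
    fun φ hφ => ?_, intertwiningMatrix, hsymp,
    fun φ ψ hφ hψ => ((hint φ hφ).mul (hint ψ hψ)).intertwiningMatrix_eq,
    fun X hX => ?_, fun φ ψ hφ hψ => ⟨fun h => ?_, ?_⟩⟩
  · obtain ⟨Y, hY⟩ := exists_mul_eq_one_of_symplectic (hsymp φ hφ)
    exact ⟨((hint φ hφ).inv hY).mem_Nset, hφ.2.inv⟩
  · obtain ⟨φ, hφ, hφX⟩ := exists_intertwines_of_symplectic hX
    exact ⟨φ, ⟨hφX.mem_Nset, hφ⟩, hφX.intertwiningMatrix_eq⟩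
  · obtain ⟨Y, hY⟩ := exists_mul_eq_one_of_symplectic (hsymp ψ hψ)
    have h1 := (hint φ hφ).mul ((hint ψ hψ).inv hY)
    rw [h, hY] at h1
    exact ⟨φ * ψ⁻¹, h1.mem_Gset_of_one (hφ.2.mul hψ.2.inv), (inv_mul_cancel_right φ ψ).symm⟩
  · rintro ⟨h, hh, rfl⟩
    obtain ⟨v, rfl⟩ := mem_Gset_iff.mp hh
    exact ((hint ψ hψ).adWeyl_mul v).intertwiningMatrix_eq
end
end

section
/- Let n be a prime. The subgroup of the group of invertible 4×4 matrices over ℤ/nℤ generated by the four matrices D₁, D₂, D₃, D₄ is exactly the symplectic group Sp(4, ℤ/nℤ) = {X ∈ (ℤ/nℤ)^{4×4} : Xᵀ J X = J}. -/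
open Matrix

noncomputable section

def D1 (n : ℕ) : Matrix (Fin 4) (Fin 4) (ZMod n) := !![1,1,0,0; 0,1,0,0; 0,0,1,0; 0,0,0,1]
def D2 (n : ℕ) : Matrix (Fin 4) (Fin 4) (ZMod n) := !![0,1,0,0; -1,0,0,0; 0,0,1,0; 0,0,0,1]
def D3 (n : ℕ) : Matrix (Fin 4) (Fin 4) (ZMod n) := !![0,0,1,0; 0,0,0,1; 1,0,0,0; 0,1,0,0]
def D4 (n : ℕ) : Matrix (Fin 4) (Fin 4) (ZMod n) := !![1,0,0,0; 0,1,0,-1; 1,0,1,0; 0,0,0,1]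

def Smat (n : ℕ) (k : ZMod n) : Matrix (Fin 4) (Fin 4) (ZMod n) :=
  !![1,0,1,0; 0,k,0,1-k; k-1,0,k,0; 0,-1,0,1]

/-- A submonoid of matrices containing `D1`, `D2`, `D3`, `D4` and closed under left cancellation. -/
structure ContainsGenerators (n : ℕ) (S : Submonoid (Matrix (Fin 4) (Fin 4) (ZMod n))) : Prop where
  cancel : ∀ {A B : Matrix (Fin 4) (Fin 4) (ZMod n)}, A ∈ S → A * B ∈ S → B ∈ S
  d1 : D1 n ∈ S
  d2 : D2 n ∈ S
  d3 : D3 n ∈ S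
  d4 : D4 n ∈ S

namespace ContainsGenerators

variable {n : ℕ} {S : Submonoid (Matrix (Fin 4) (Fin 4) (ZMod n))}

theorem upper_mem [NeZero n] (h : ContainsGenerators n S) (a : ZMod n) :
    !![1,a,0,0; 0,1,0,0; 0,0,1,0; 0,0,0,1] ∈ S := by
  have key : ∀ k : ℕ, (!![1,(k : ZMod n),0,0; 0,1,0,0; 0,0,1,0; 0,0,0,1] :
      Matrix (Fin 4) (Fin 4) (ZMod n)) ∈ S := by
    intro k
    induction k with
    | zero =>
      convert S.one_mem using 1
      ext i j; fin_cases i <;> fin_cases j <;> simp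
    | succ k ih =>
      convert S.mul_mem h.d1 ih using 1
      ext i j; fin_cases i <;> fin_cases j <;> simp [D1, Matrix.mul_apply, Fin.sum_univ_four]
  obtain ⟨k, rfl⟩ := ZMod.natCast_zmod_surjective a
  exact key k

theorem lower_mem [NeZero n] (h : ContainsGenerators n S) (a : ZMod n) :
    !![1,0,0,0; a,1,0,0; 0,0,1,0; 0,0,0,1] ∈ S := by
  refine h.cancel h.d2 ?_
  convert S.mul_mem (h.upper_mem (-a)) h.d2 using 1
  ext i j; fin_cases i <;> fin_cases j <;> simp [D2, Matrix.mul_apply, Fin.sum_univ_four]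

theorem upper_snd_mem [NeZero n] (h : ContainsGenerators n S) (a : ZMod n) :
    !![1,0,0,0; 0,1,0,0; 0,0,1,a; 0,0,0,1] ∈ S := by
  convert S.mul_mem (S.mul_mem h.d3 (h.upper_mem a)) h.d3 using 1
  ext i j; fin_cases i <;> fin_cases j <;> simp [D3, Matrix.mul_apply, Fin.sum_univ_four]

/-- The inverse of `D4` lies in `S`. -/
theorem d4_inv_mem (h : ContainsGenerators n S) :
    !![1,0,0,0; 0,1,0,1; -1,0,1,0; 0,0,0,1] ∈ S := by
  refine h.cancel h.d4 ?_
  convert S.one_mem using 1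
  ext i j; fin_cases i <;> fin_cases j <;> simp [D4, Matrix.mul_apply, Fin.sum_univ_four]

theorem d3_mulVec (x y z w : ZMod n) : D3 n *ᵥ ![x, y, z, w] = ![z, w, x, y] := by
  ext i; fin_cases i <;> simp [D3, Matrix.mulVec, dotProduct, Fin.sum_univ_four]

theorem exists_mulVec_of_snd_ne_zero [Fact n.Prime] (h : ContainsGenerators n S)
    (x : ZMod n) {y : ZMod n} (hy : y ≠ 0) :
    ∃ A ∈ S, (∀ z w, A *ᵥ ![0, 0, z, w] = ![0, 0, z, w]) ∧
      ∀ z w, A *ᵥ ![x, y, z, w] = ![1, 0, z, w] := by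
  refine ⟨_, S.mul_mem (h.lower_mem (-y)) (h.upper_mem ((1 - x) / y)), ?_, ?_⟩ <;>
  · intro z w
    rw [← Matrix.mulVec_mulVec]
    ext i
    fin_cases i <;> simp [Matrix.mulVec, dotProduct, Fin.sum_univ_four, hy]

/-- `S` acts transitively on nonzero vectors of the first plane, fixing the second plane. -/
theorem exists_mulVec_fst [Fact n.Prime] (h : ContainsGenerators n S)
    {x y : ZMod n} (hxy : ¬(x = 0 ∧ y = 0)) :
    ∃ A ∈ S, (∀ z w, A *ᵥ ![0, 0, z, w] = ![0, 0, z, w]) ∧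
      ∀ z w, A *ᵥ ![x, y, z, w] = ![1, 0, z, w] := by
  by_cases hy : y = 0
  · have hx : x ≠ 0 := fun hx => hxy ⟨hx, hy⟩
    obtain ⟨A, hA, hA₀, hA₁⟩ := h.exists_mulVec_of_snd_ne_zero x hx
    have hL : ∀ x z w : ZMod n, !![1,0,0,0; 1,1,0,0; 0,0,1,0; 0,0,0,1] *ᵥ ![x, 0, z, w] =
        ![x, x, z, w] := by
      intro x z w
      ext i; fin_cases i <;> simp [Matrix.mulVec, dotProduct, Fin.sum_univ_four]
    refine ⟨_, S.mul_mem hA (h.lower_mem 1), fun z w => ?_, fun z w => ?_⟩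
    · rw [← Matrix.mulVec_mulVec, hL, hA₀]
    · rw [hy, ← Matrix.mulVec_mulVec, hL, hA₁]
  · exact h.exists_mulVec_of_snd_ne_zero x hy

/-- `S` acts transitively on nonzero vectors of the second plane, fixing the first plane. -/
theorem exists_mulVec_snd [Fact n.Prime] (h : ContainsGenerators n S)
    {z w : ZMod n} (hzw : ¬(z = 0 ∧ w = 0)) :
    ∃ A ∈ S, (∀ x y, A *ᵥ ![x, y, 0, 0] = ![x, y, 0, 0]) ∧
      ∀ x y, A *ᵥ ![x, y, z, w] = ![x, y, 1, 0] := by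
  obtain ⟨A, hA, hA₀, hA₁⟩ := h.exists_mulVec_fst hzw
  refine ⟨D3 n * A * D3 n, S.mul_mem (S.mul_mem h.d3 hA) h.d3, fun x y => ?_, fun x y => ?_⟩
  · simp only [← Matrix.mulVec_mulVec, d3_mulVec, hA₀]
  · simp only [← Matrix.mulVec_mulVec, d3_mulVec, hA₁]

/-- `S` acts transitively on nonzero vectors. -/
theorem exists_mulVec_eq [Fact n.Prime] (h : ContainsGenerators n S)
    {v : Fin 4 → ZMod n} (hv : v ≠ 0) : ∃ A ∈ S, A *ᵥ v = ![1, 0, 0, 0] := by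
  obtain ⟨x, y, z, w, rfl⟩ : ∃ x y z w, v = ![x, y, z, w] :=
    ⟨v 0, v 1, v 2, v 3, by ext i; fin_cases i <;> rfl⟩
  by_cases hxy : x = 0 ∧ y = 0
  · obtain ⟨rfl, rfl⟩ := hxy
    have hzw : ¬(z = 0 ∧ w = 0) := by
      rintro ⟨rfl, rfl⟩
      exact hv (by ext i; fin_cases i <;> rfl)
    obtain ⟨A, hA, -, hA₁⟩ := h.exists_mulVec_snd hzw
    exact ⟨_, S.mul_mem h.d3 hA, by rw [← Matrix.mulVec_mulVec, hA₁, d3_mulVec]⟩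
  · obtain ⟨A, hA, -, hA₁⟩ := h.exists_mulVec_fst hxy
    by_cases hzw : z = 0 ∧ w = 0
    · obtain ⟨rfl, rfl⟩ := hzw
      exact ⟨A, hA, hA₁ 0 0⟩
    · obtain ⟨B, hB, -, hB₁⟩ := h.exists_mulVec_snd hzw
      refine ⟨_, S.mul_mem h.d4_inv_mem (S.mul_mem hB hA), ?_⟩
      rw [← Matrix.mulVec_mulVec, ← Matrix.mulVec_mulVec, hA₁, hB₁]
      ext i; fin_cases i <;> simp [Matrix.mulVec, dotProduct, Fin.sum_univ_four]

/-- The stabilizer in `S` of the first basis vector acts transitively on the vectors pairing to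
`1` with it. -/
theorem exists_mulVec_stabilizer [Fact n.Prime] (h : ContainsGenerators n S) (a b c : ZMod n) :
    ∃ A ∈ S, A *ᵥ ![1, 0, 0, 0] = ![1, 0, 0, 0] ∧ A *ᵥ ![a, 1, b, c] = ![0, 1, 0, 0] := by
  by_cases hbc : b = 0 ∧ c = 0
  · obtain ⟨rfl, rfl⟩ := hbc
    refine ⟨_, h.upper_mem (-a), ?_, ?_⟩ <;>
    · ext i; fin_cases i <;> simp [Matrix.mulVec, dotProduct, Fin.sum_univ_four]
  · obtain ⟨A, hA, hA₀, hA₁⟩ := h.exists_mulVec_snd hbc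
    have hmem : !![1,-a,0,0; 0,1,0,0; 0,0,1,0; 0,0,0,1] * (D3 n *
        !![1,0,0,0; 0,1,0,1; -1,0,1,0; 0,0,0,1] * D2 n * D3 n) * A ∈ S :=
      S.mul_mem (S.mul_mem (h.upper_mem (-a))
        (S.mul_mem (S.mul_mem (S.mul_mem h.d3 h.d4_inv_mem) h.d2) h.d3)) hA
    refine ⟨_, hmem, ?_, ?_⟩
    · rw [← Matrix.mulVec_mulVec, hA₀]
      simp only [← Matrix.mulVec_mulVec, d3_mulVec]
      ext i; fin_cases i <;>
        simp [D2, D3, Matrix.mulVec, dotProduct, Fin.sum_univ_four]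
    · rw [← Matrix.mulVec_mulVec, hA₁]
      simp only [← Matrix.mulVec_mulVec, d3_mulVec]
      ext i; fin_cases i <;>
        simp [D2, D3, Matrix.mulVec, dotProduct, Fin.sum_univ_four]

end ContainsGenerators

/-- The symplectic matrices with respect to `J4`. -/
def symplecticSubmonoid (n : ℕ) : Submonoid (Matrix (Fin 4) (Fin 4) (ZMod n)) where
  carrier := {X | Xᵀ * J4 n * X = J4 n}
  one_mem' := by simp
  mul_mem' {A B} hA hB := by
    simp only [Set.mem_ofPred_eq] at hA hB ⊢
    calc (A * B)ᵀ * J4 n * (A * B) = Bᵀ * (Aᵀ * J4 n * A) * B := by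
          simp only [Matrix.transpose_mul, Matrix.mul_assoc]
      _ = J4 n := by rw [hA, hB]

theorem mem_symplecticSubmonoid {n : ℕ} {X : Matrix (Fin 4) (Fin 4) (ZMod n)} :
    X ∈ symplecticSubmonoid n ↔ Xᵀ * J4 n * X = J4 n := Iff.rfl

theorem inv_mem_symplecticSubmonoid {n : ℕ} {u : GL (Fin 4) (ZMod n)}
    (hu : (u : Matrix (Fin 4) (Fin 4) (ZMod n)) ∈ symplecticSubmonoid n) :
    ((u⁻¹ : GL (Fin 4) (ZMod n)) : Matrix (Fin 4) (Fin 4) (ZMod n)) ∈ symplecticSubmonoid n := by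
  rw [mem_symplecticSubmonoid] at hu ⊢
  set A := (u : Matrix (Fin 4) (Fin 4) (ZMod n))
  set B := ((u⁻¹ : GL (Fin 4) (ZMod n)) : Matrix (Fin 4) (Fin 4) (ZMod n))
  have hAB : A * B = 1 := u.mul_inv
  calc Bᵀ * J4 n * B = Bᵀ * (Aᵀ * J4 n * A) * B := by rw [hu]
    _ = (A * B)ᵀ * J4 n * (A * B) := by simp only [Matrix.transpose_mul, Matrix.mul_assoc]
    _ = J4 n := by simp [hAB]

/-- The pairing of two columns of a symplectic matrix. -/
theorem symplectic_pairing {n : ℕ} {X : Matrix (Fin 4) (Fin 4) (ZMod n)}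
    (hX : X ∈ symplecticSubmonoid n) (i j : Fin 4) :
    X 0 i * X 1 j - X 1 i * X 0 j + (X 2 i * X 3 j - X 3 i * X 2 j) = J4 n i j := by
  rw [← mem_symplecticSubmonoid.1 hX]
  simp [J4, Matrix.mul_apply, Fin.sum_univ_four]
  ring

theorem mul_apply_of_mulVec_col {n : ℕ} {A X : Matrix (Fin 4) (Fin 4) (ZMod n)}
    {v : Fin 4 → ZMod n} {j : Fin 4} (h : A *ᵥ (fun i => X i j) = v) (i : Fin 4) :
    (A * X) i j = v i := by
  rw [← h]; rfl

theorem D_mem_symplecticSubmonoid (n : ℕ) : D1 n ∈ symplecticSubmonoid n ∧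
    D2 n ∈ symplecticSubmonoid n ∧ D3 n ∈ symplecticSubmonoid n ∧ D4 n ∈ symplecticSubmonoid n := by
  refine ⟨?_, ?_, ?_, ?_⟩ <;>
  · rw [mem_symplecticSubmonoid]
    ext i j
    fin_cases i <;> fin_cases j <;>
      simp [D1, D2, D3, D4, J4, Matrix.mul_apply, Fin.sum_univ_four]

namespace ContainsGenerators

variable {n : ℕ} {S : Submonoid (Matrix (Fin 4) (Fin 4) (ZMod n))}

/-- A symplectic matrix whose first two columns are standard basis vectors lies in `S`. -/
theorem mem_of_cols [Fact n.Prime] (h : ContainsGenerators n S)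
    (hS : S ≤ symplecticSubmonoid n)
    {X : Matrix (Fin 4) (Fin 4) (ZMod n)} (hX : X ∈ symplecticSubmonoid n)
    (h₀ : ∀ i, X i 0 = ![1, 0, 0, 0] i) (h₁ : ∀ i, X i 1 = ![0, 1, 0, 0] i) : X ∈ S := by
  have e02 := symplectic_pairing hX 0 2
  have e03 := symplectic_pairing hX 0 3
  have e12 := symplectic_pairing hX 1 2
  have e13 := symplectic_pairing hX 1 3
  have e23 := symplectic_pairing hX 2 3
  simp [h₀, h₁, J4] at e02 e03 e12 e13
  simp [e02, e03, e12, e13, J4] at e23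
  have hne : ¬(X 2 2 = 0 ∧ X 3 2 = 0) := by
    rintro ⟨hp, hr⟩
    simp [hp, hr] at e23
  obtain ⟨A, hA, hA₀, hA₁⟩ := h.exists_mulVec_snd hne
  have c0 : (fun i => X i 0) = ![1, 0, 0, 0] := funext h₀
  have c1 : (fun i => X i 1) = ![0, 1, 0, 0] := funext h₁
  have c2 : (fun i => X i 2) = ![0, 0, X 2 2, X 3 2] := by
    ext i; fin_cases i <;> simp [e02, e12]
  have hY := (symplecticSubmonoid n).mul_mem (hS hA) hX
  have y0 := mul_apply_of_mulVec_col ((congrArg (A *ᵥ ·) c0).trans (hA₀ 1 0))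
  have y1 := mul_apply_of_mulVec_col ((congrArg (A *ᵥ ·) c1).trans (hA₀ 0 1))
  have y2 := mul_apply_of_mulVec_col ((congrArg (A *ᵥ ·) c2).trans (hA₁ 0 0))
  refine h.cancel hA ?_
  generalize A * X = Y at hY y0 y1 y2
  have f03 := symplectic_pairing hY 0 3
  have f13 := symplectic_pairing hY 1 3
  have f23 := symplectic_pairing hY 2 3
  simp [y0, y1, y2, J4] at f03 f13 f23
  convert h.upper_snd_mem (Y 2 3) using 1
  ext i j
  fin_cases i <;> fin_cases j <;> simp [y0, y1, y2, f03, f13, f23]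

/-- Every symplectic matrix lies in `S`. -/
theorem mem_of_symplectic [Fact n.Prime] (h : ContainsGenerators n S)
    (hS : S ≤ symplecticSubmonoid n)
    {X : Matrix (Fin 4) (Fin 4) (ZMod n)} (hX : X ∈ symplecticSubmonoid n) : X ∈ S := by
  have hne : (fun i => X i 0) ≠ 0 := by
    intro h0
    have h0' : ∀ i, X i 0 = 0 := congrFun h0
    have := symplectic_pairing hX 0 1
    simp [h0', J4] at this
  obtain ⟨A, hA, hA₁⟩ := h.exists_mulVec_eq hne
  refine h.cancel hA ?_
  have hY := (symplecticSubmonoid n).mul_mem (hS hA) hX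
  have hY₀ := mul_apply_of_mulVec_col hA₁
  generalize A * X = Y at hY hY₀
  have e01 : Y 1 1 = 1 := by
    simpa [hY₀, J4] using symplectic_pairing hY 0 1
  obtain ⟨B, hB, hB₀, hB₁⟩ := h.exists_mulVec_stabilizer (Y 0 1) (Y 2 1) (Y 3 1)
  refine h.cancel hB (h.mem_of_cols hS ((symplecticSubmonoid n).mul_mem (hS hB) hY) ?_ ?_)
  · refine mul_apply_of_mulVec_col ?_
    rw [← hB₀]
    exact congrArg _ (funext hY₀)
  · refine mul_apply_of_mulVec_col ?_
    rw [← hB₁]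
    congr 1
    ext i; fin_cases i <;> simp [e01]

end ContainsGenerators

/-- For `n` prime, the subgroup of `GL(4, ℤ/nℤ)` generated by
`D₁, D₂, D₃, D₄` is exactly `Sp(4, ℤ/nℤ) = {X : Xᵀ J X = J}`.  The generators are given
as invertible matrices `d₁, …, d₄` whose underlying matrices are `D₁, …, D₄`. -/
theorem statement7 (n : ℕ) (hn : n.Prime)
    (d₁ d₂ d₃ d₄ : GL (Fin 4) (ZMod n))
    (h₁ : (d₁ : Matrix (Fin 4) (Fin 4) (ZMod n)) = D1 n)
    (h₂ : (d₂ : Matrix (Fin 4) (Fin 4) (ZMod n)) = D2 n)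
    (h₃ : (d₃ : Matrix (Fin 4) (Fin 4) (ZMod n)) = D3 n)
    (h₄ : (d₄ : Matrix (Fin 4) (Fin 4) (ZMod n)) = D4 n) :
    (fun u : GL (Fin 4) (ZMod n) => (u : Matrix (Fin 4) (Fin 4) (ZMod n))) ''
        (Subgroup.closure {d₁, d₂, d₃, d₄} : Set (GL (Fin 4) (ZMod n)))
      = {X : Matrix (Fin 4) (Fin 4) (ZMod n) | Xᵀ * J4 n * X = J4 n} := by
  have : Fact n.Prime := ⟨hn⟩
  set S := (Subgroup.closure {d₁, d₂, d₃, d₄}).toSubmonoid.map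
    (Units.coeHom (Matrix (Fin 4) (Fin 4) (ZMod n)))
  have hgen : ContainsGenerators n S :=
    { cancel := by
        rintro _ B ⟨u, hu, rfl⟩ ⟨v, hv, hB⟩
        refine ⟨u⁻¹ * v, (Subgroup.closure _).mul_mem ((Subgroup.closure _).inv_mem hu) hv, ?_⟩
        rw [map_mul, hB]
        simp
      d1 := ⟨d₁, Subgroup.subset_closure (by simp), h₁⟩
      d2 := ⟨d₂, Subgroup.subset_closure (by simp), h₂⟩
      d3 := ⟨d₃, Subgroup.subset_closure (by simp), h₃⟩
      d4 := ⟨d₄, Subgroup.subset_closure (by simp), h₄⟩ }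
  obtain ⟨m₁, m₂, m₃, m₄⟩ := D_mem_symplecticSubmonoid n
  have hS : S ≤ symplecticSubmonoid n := by
    rintro _ ⟨u, hu, rfl⟩
    change (u : Matrix (Fin 4) (Fin 4) (ZMod n)) ∈ symplecticSubmonoid n
    induction hu using Subgroup.closure_induction with
    | mem x hx =>
      rcases hx with rfl | rfl | rfl | rfl
      · rwa [h₁]
      · rwa [h₂]
      · rwa [h₃]
      · rwa [h₄]
    | one => exact one_mem _
    | mul x y _ _ hx hy => exact mul_mem hx hy
    | inv x _ hx => exact inv_mem_symplecticSubmonoid hx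
  ext X
  exact ⟨fun hX => hS hX, fun hX => hgen.mem_of_symplectic hS hX⟩
end
end

section
/- Let n be a prime, let H be the subgroup of Sp(4, ℤ/nℤ) generated by D₁, D₂, D₃, and let M ∈ Sp(4, ℤ/nℤ) be a matrix with M ∉ H. Then there exist k ∈ ℤ/nℤ and matrices G₁, G₂ ∈ H such that G₁·M·G₂ = S(k). -/
open Matrix

noncomputable section

/-- The 4×4 matrix with the given 2×2 blocks. -/
def blocks {R : Type*} (A B C D : Matrix (Fin 2) (Fin 2) R) : Matrix (Fin 4) (Fin 4) R :=
  !![A 0 0, A 0 1, B 0 0, B 0 1; A 1 0, A 1 1, B 1 0, B 1 1;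
     C 0 0, C 0 1, D 0 0, D 0 1; C 1 0, C 1 1, D 1 0, D 1 1]

lemma blocks_mul {R : Type*} [CommRing R] (A B C D A' B' C' D' : Matrix (Fin 2) (Fin 2) R) :
    blocks A B C D * blocks A' B' C' D' =
      blocks (A * A' + B * C') (A * B' + B * D') (C * A' + D * C') (C * B' + D * D') := by
  ext i j
  fin_cases i <;> fin_cases j <;>
    simp [blocks, Matrix.mul_apply, Fin.sum_univ_four, add_assoc]

lemma exists_eq_blocks {R : Type*} (M : Matrix (Fin 4) (Fin 4) R) :
    ∃ A B C D, M = blocks A B C D := by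
  refine ⟨!![M 0 0, M 0 1; M 1 0, M 1 1], !![M 0 2, M 0 3; M 1 2, M 1 3],
    !![M 2 0, M 2 1; M 3 0, M 3 1], !![M 2 2, M 2 3; M 3 2, M 3 3], ?_⟩
  ext i j
  fin_cases i <;> fin_cases j <;> simp [blocks]

/-- Every nonzero vector of a plane over a field is moved to the first basis vector by a matrix of
determinant one. -/
lemma exists_det_one_map_to_basis {F : Type*} [Field F] (x y : F) (h : x ≠ 0 ∨ y ≠ 0) :
    ∃ P : Matrix (Fin 2) (Fin 2) F, P.det = 1 ∧
      P 0 0 * x + P 0 1 * y = 1 ∧ P 1 0 * x + P 1 1 * y = 0 := by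
  rcases h with h | h
  · refine ⟨!![x⁻¹, 0; -y, x], ?_, ?_, ?_⟩ <;> simp [Matrix.det_fin_two, h]; ring
  · refine ⟨!![0, y⁻¹; -y, x], ?_, ?_, ?_⟩ <;> simp [Matrix.det_fin_two, h]; ring

/-- A nonzero 2×2 matrix `X` is equivalent to `diag(1, det X)` under multiplication by matrices of
determinant one. -/
lemma exists_det_one_mul_mul_eq {F : Type*} [Field F] (X : Matrix (Fin 2) (Fin 2) F)
    (hX : X ≠ 0) :
    ∃ P Q : Matrix (Fin 2) (Fin 2) F, P.det = 1 ∧ Q.det = 1 ∧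
      P * X * Q = !![1, 0; 0, X.det] := by
  have key : ∀ Y : Matrix (Fin 2) (Fin 2) F, (Y 0 0 ≠ 0 ∨ Y 1 0 ≠ 0) →
      ∃ P Q : Matrix (Fin 2) (Fin 2) F, P.det = 1 ∧ Q.det = 1 ∧
        P * Y * Q = !![1, 0; 0, Y.det] := by
    intro Y hY
    obtain ⟨P, hP, h0, h1⟩ := exists_det_one_map_to_basis _ _ hY
    refine ⟨P, !![1, -(P * Y) 0 1; 0, 1], hP, by simp [Matrix.det_fin_two], ?_⟩
    have hd : (P * Y).det = Y.det := by rw [Matrix.det_mul, hP, one_mul]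
    have h00 : (P * Y) 0 0 = 1 := by simpa [Matrix.mul_apply] using h0
    have h10 : (P * Y) 1 0 = 0 := by simpa [Matrix.mul_apply] using h1
    rw [Matrix.det_fin_two, h00, h10] at hd
    rw [Matrix.eta_fin_two (P * Y), h00, h10, ← hd]
    simp
  by_cases h : X 0 0 ≠ 0 ∨ X 1 0 ≠ 0
  · exact key X h
  · have h' : X 0 1 ≠ 0 ∨ X 1 1 ≠ 0 := by
      by_contra h'
      push Not at h h'
      apply hX
      ext i j
      fin_cases i <;> fin_cases j <;> simp [h, h']
    obtain ⟨P, Q, hP, hQ, e⟩ := key (X * !![0, -1; 1, 0]) (by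
      simpa [Matrix.mul_apply] using h')
    refine ⟨P, !![0, -1; 1, 0] * Q, hP, by rw [Matrix.det_mul, hQ]; simp, ?_⟩
    rw [← Matrix.mul_assoc, Matrix.mul_assoc P, e]
    simp [Matrix.det_fin_two]

/-- Over `ℤ/pℤ` the two standard generators generate all matrices of determinant one. -/
lemma mem_of_det_eq_one {n : ℕ} [Fact n.Prime] (K : Submonoid (Matrix (Fin 2) (Fin 2) (ZMod n)))
    (hT : !![1, 1; 0, 1] ∈ K) (hS : !![0, 1; -1, 0] ∈ K)
    (P : Matrix (Fin 2) (Fin 2) (ZMod n)) (hP : P.det = 1) : P ∈ K := by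
  have hU : ∀ x : ZMod n, !![1, x; 0, 1] ∈ K := by
    intro x
    obtain ⟨m, rfl⟩ := ZMod.natCast_zmod_surjective x
    induction m with
    | zero => simpa [Matrix.one_fin_two] using K.one_mem
    | succ m ih =>
      convert K.mul_mem hT ih using 1
      simp
  have hL : ∀ x : ZMod n, !![1, 0; x, 1] ∈ K := by
    intro x
    convert K.mul_mem (K.mul_mem hS (hU (-x))) (K.mul_mem hS (K.mul_mem hS hS)) using 1
    simp
  have key : ∀ P : Matrix (Fin 2) (Fin 2) (ZMod n), P.det = 1 → P 1 0 ≠ 0 → P ∈ K := by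
    intro P hP hc
    convert K.mul_mem (K.mul_mem (hU ((P 0 0 - 1) / P 1 0)) (hL (P 1 0)))
      (hU ((P 1 1 - 1) / P 1 0)) using 1
    rw [Matrix.det_fin_two] at hP
    ext i j
    fin_cases i <;> fin_cases j <;> simp [hc]
    · field_simp
      linear_combination -hP
    · field_simp
      ring
  by_cases hc : P 1 0 = 0
  · have ha : P 0 0 ≠ 0 := by
      intro ha
      simp [Matrix.det_fin_two, ha, hc] at hP
    have := key (!![1, 0; 1, 1] * P) (by rw [Matrix.det_mul, hP]; simp)
      (by simpa [Matrix.mul_apply, hc] using ha)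
    convert K.mul_mem (hL (-1)) this using 1
    rw [← Matrix.mul_assoc]
    simp [← Matrix.one_fin_two]
  · exact key P hP hc

lemma D3_eq_blocks {n : ℕ} : D3 n = blocks 0 1 1 0 := by
  ext i j
  fin_cases i <;> fin_cases j <;> simp [blocks, D3]

lemma blocks_diagonal_mem {n : ℕ} [Fact n.Prime] (T : Submonoid (Matrix (Fin 4) (Fin 4) (ZMod n)))
    (h₁ : D1 n ∈ T) (h₂ : D2 n ∈ T) (h₃ : D3 n ∈ T)
    (P Q : Matrix (Fin 2) (Fin 2) (ZMod n)) (hP : P.det = 1) (hQ : Q.det = 1) :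
    blocks P 0 0 Q ∈ T := by
  let K : Submonoid (Matrix (Fin 2) (Fin 2) (ZMod n)) :=
    { carrier := {X | blocks X 0 0 1 ∈ T}
      one_mem' := by
        have : blocks (1 : Matrix (Fin 2) (Fin 2) (ZMod n)) 0 0 1 = 1 := by
          ext i j
          fin_cases i <;> fin_cases j <;> simp [blocks]
        simp [this]
      mul_mem' := by
        intro X Y hX hY
        simpa [blocks_mul] using T.mul_mem hX hY }
  have hK : ∀ X : Matrix (Fin 2) (Fin 2) (ZMod n), X.det = 1 → blocks X 0 0 1 ∈ T := by
    refine mem_of_det_eq_one K ?_ ?_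
    · change blocks _ _ _ _ ∈ T
      convert h₁ using 1
      ext i j
      fin_cases i <;> fin_cases j <;> simp [blocks, D1]
    · change blocks _ _ _ _ ∈ T
      convert h₂ using 1
      ext i j
      fin_cases i <;> fin_cases j <;> simp [blocks, D2]
  rw [D3_eq_blocks] at h₃
  simpa [blocks_mul] using
    T.mul_mem (hK P hP) (T.mul_mem h₃ (T.mul_mem (hK Q hQ) h₃))

lemma D3_mul_D3 {n : ℕ} : D3 n * D3 n = 1 := by
  ext i j
  fin_cases i <;> fin_cases j <;> simp [D3, Matrix.mul_apply, Fin.sum_univ_four]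

/-- The matrix equation defining the symplectic group. -/
def IsSymp {n : ℕ} (M : Matrix (Fin 4) (Fin 4) (ZMod n)) : Prop := Mᵀ * J4 n * M = J4 n

lemma IsSymp.mul {n : ℕ} {M N : Matrix (Fin 4) (Fin 4) (ZMod n)} (hM : IsSymp M) (hN : IsSymp N) :
    IsSymp (M * N) := by
  unfold IsSymp at *
  calc (M * N)ᵀ * J4 n * (M * N) = Nᵀ * (Mᵀ * J4 n * M) * N := by
        simp only [Matrix.transpose_mul, Matrix.mul_assoc]
    _ = J4 n := by rw [hM, hN]

lemma isSymp_D3 {n : ℕ} : IsSymp (D3 n) := by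
  unfold IsSymp
  ext i j
  fin_cases i <;> fin_cases j <;> simp [D3, J4, Matrix.mul_apply, Fin.sum_univ_four]

lemma isSymp_blocks_diagonal {n : ℕ} (P Q : Matrix (Fin 2) (Fin 2) (ZMod n))
    (hP : P.det = 1) (hQ : Q.det = 1) : IsSymp (blocks P 0 0 Q) := by
  rw [Matrix.det_fin_two] at hP hQ
  unfold IsSymp
  ext i j
  fin_cases i <;> fin_cases j <;>
    simp [blocks, J4, Matrix.mul_apply, Fin.sum_univ_four] <;>
    first
    | ring1
    | linear_combination hP
    | linear_combination -hP
    | linear_combination hQ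
    | linear_combination -hQ

/-- The transpose of a symplectic matrix is symplectic. -/
lemma IsSymp.mul_mul_transpose {n : ℕ} {M : Matrix (Fin 4) (Fin 4) (ZMod n)} (hM : IsSymp M) :
    M * J4 n * Mᵀ = J4 n := by
  have hJ : J4 n * J4 n = -1 := by
    ext i j
    fin_cases i <;> fin_cases j <;> simp [J4, Matrix.mul_apply, Fin.sum_univ_four]
  have h : (-(J4 n * Mᵀ * J4 n)) * M = 1 := by
    rw [Matrix.neg_mul, Matrix.mul_assoc, Matrix.mul_assoc, ← Matrix.mul_assoc Mᵀ, hM, hJ, neg_neg]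
  have h' := _root_.mul_eq_one_comm.mp h
  calc M * J4 n * Mᵀ = M * (-(J4 n * Mᵀ * J4 n)) * J4 n := by
        simp only [Matrix.mul_neg, Matrix.neg_mul, Matrix.mul_assoc, hJ]
        simp
    _ = J4 n := by rw [h', Matrix.one_mul]

lemma IsSymp.det_add_det_left {n : ℕ} {A B C D : Matrix (Fin 2) (Fin 2) (ZMod n)}
    (h : IsSymp (blocks A B C D)) : A.det + C.det = 1 := by
  have := congrFun₂ h 0 1
  simp [blocks, J4, Matrix.mul_apply, Fin.sum_univ_four] at this
  rw [Matrix.det_fin_two, Matrix.det_fin_two]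
  linear_combination this

lemma IsSymp.det_add_det_top {n : ℕ} {A B C D : Matrix (Fin 2) (Fin 2) (ZMod n)}
    (h : IsSymp (blocks A B C D)) : A.det + B.det = 1 := by
  have := congrFun₂ h.mul_mul_transpose 0 1
  simp [blocks, J4, Matrix.mul_apply, Fin.sum_univ_four] at this
  rw [Matrix.det_fin_two, Matrix.det_fin_two]
  linear_combination this

/-- If the lower left block `C` is invertible, the other three blocks determine the last one. -/
lemma IsSymp.blocks_unique {n : ℕ} [Fact n.Prime] {A B C D D' : Matrix (Fin 2) (Fin 2) (ZMod n)}
    (h : IsSymp (blocks A B C D)) (h' : IsSymp (blocks A B C D')) (hC : C.det ≠ 0) :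
    D = D' := by
  have e := fun i j => (congrFun₂ h i j).trans (congrFun₂ h' i j).symm
  have e02 := e 0 2
  have e03 := e 0 3
  have e12 := e 1 2
  have e13 := e 1 3
  simp [blocks, J4, Matrix.mul_apply, Fin.sum_univ_four] at e02 e03 e12 e13
  rw [Matrix.det_fin_two] at hC
  ext i j
  apply mul_left_cancel₀ hC
  fin_cases i <;> fin_cases j <;> simp only [Fin.zero_eta, Fin.mk_one, Fin.isValue]
  · linear_combination C 0 1 * e02 - C 0 0 * e12
  · linear_combination C 0 1 * e03 - C 0 0 * e13
  · linear_combination C 1 1 * e02 - C 1 0 * e12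
  · linear_combination C 1 1 * e03 - C 1 0 * e13

lemma Smat_eq_blocks {n : ℕ} (k : ZMod n) :
    Smat n k = blocks !![1, 0; 0, k] !![1, 0; 0, 1 - k] !![k - 1, 0; 0, -1] !![k, 0; 0, 1] := by
  ext i j
  fin_cases i <;> fin_cases j <;> simp [blocks, Smat]

lemma isSymp_Smat {n : ℕ} (k : ZMod n) : IsSymp (Smat n k) := by
  unfold IsSymp
  ext i j
  fin_cases i <;> fin_cases j <;>
    simp [Smat, J4, Matrix.mul_apply, Fin.sum_univ_four] <;> ring

lemma exists_mul_mul_eq_Smat_of_det_ne_one {n : ℕ} [Fact n.Prime]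
    (T : Submonoid (Matrix (Fin 4) (Fin 4) (ZMod n)))
    (h₁ : D1 n ∈ T) (h₂ : D2 n ∈ T) (h₃ : D3 n ∈ T)
    {A B C D : Matrix (Fin 2) (Fin 2) (ZMod n)} (hM : IsSymp (blocks A B C D))
    (hMT : blocks A B C D ∉ T) (hA : A.det ≠ 1) :
    ∃ X ∈ T, ∃ Y ∈ T, X * blocks A B C D * Y = Smat n A.det := by
  have hAC := hM.det_add_det_left
  have hAB := hM.det_add_det_top
  have hA1 : 1 - A.det ≠ 0 := sub_ne_zero.mpr hA.symm
  have hC : C.det = 1 - A.det := by linear_combination hAC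
  have hB : B.det = 1 - A.det := by linear_combination hAB
  have hA0 : A ≠ 0 := by
    rintro rfl
    have hC1 : C.det = 1 := by simpa using hC
    have hB1 : B.det = 1 := by simpa using hB
    have hs : IsSymp (blocks 0 B C 0) := by
      simpa [D3_eq_blocks, blocks_mul] using isSymp_D3.mul (isSymp_blocks_diagonal C B hC1 hB1)
    obtain rfl := hM.blocks_unique hs (by simp [hC1])
    apply hMT
    simpa [D3_eq_blocks, blocks_mul] using
      T.mul_mem h₃ (blocks_diagonal_mem T h₁ h₂ h₃ C B hC1 hB1)
  obtain ⟨P, Q, hP, hQ, e⟩ := exists_det_one_mul_mul_eq A hA0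
  have hPB : (P * B).det = 1 - A.det := by simp [hP, hB]
  have hCQ : (C * Q).det = 1 - A.det := by simp [hQ, hC]
  have uPB : IsUnit (P * B).det := by rw [hPB]; exact hA1.isUnit
  have uCQ : IsUnit (C * Q).det := by rw [hCQ]; exact hA1.isUnit
  set W := (P * B)⁻¹ * !![1, 0; 0, 1 - A.det] with hW
  set V := !![A.det - 1, 0; 0, -1] * (C * Q)⁻¹ with hV
  have eB : P * B * W = !![1, 0; 0, 1 - A.det] := Matrix.mul_nonsing_inv_cancel_left _ _ uPB
  have eC : V * (C * Q) = !![A.det - 1, 0; 0, -1] := Matrix.nonsing_inv_mul_cancel_right _ _ uCQ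
  have dW : W.det = 1 := by
    have := congrArg Matrix.det eB
    rw [Matrix.det_mul, hPB, Matrix.det_fin_two_of] at this
    apply mul_left_cancel₀ hA1
    linear_combination this
  have dV : V.det = 1 := by
    have := congrArg Matrix.det eC
    rw [Matrix.det_mul, hCQ, Matrix.det_fin_two_of] at this
    apply mul_right_cancel₀ hA1
    linear_combination this
  refine ⟨_, blocks_diagonal_mem T h₁ h₂ h₃ P V hP dV, _,
    blocks_diagonal_mem T h₁ h₂ h₃ Q W hQ dW, ?_⟩
  have hs := ((isSymp_blocks_diagonal P V hP dV).mul hM).mul (isSymp_blocks_diagonal Q W hQ dW)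
  rw [Smat_eq_blocks]
  have hN : blocks P 0 0 V * blocks A B C D * blocks Q 0 0 W =
      blocks !![1, 0; 0, A.det] !![1, 0; 0, 1 - A.det] !![A.det - 1, 0; 0, -1] (V * D * W) := by
    simp only [blocks_mul, Matrix.zero_mul, Matrix.mul_zero, add_zero, zero_add, e, eB]
    rw [Matrix.mul_assoc V C Q, eC]
  rw [hN] at hs ⊢
  have hS := isSymp_Smat A.det
  rw [Smat_eq_blocks] at hS
  rw [hs.blocks_unique hS]
  rw [Matrix.det_fin_two_of]
  intro h
  exact hA1 (by linear_combination h)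

lemma exists_mul_mul_eq_Smat {n : ℕ} [Fact n.Prime] (T : Submonoid (Matrix (Fin 4) (Fin 4) (ZMod n)))
    (h₁ : D1 n ∈ T) (h₂ : D2 n ∈ T) (h₃ : D3 n ∈ T)
    (M : Matrix (Fin 4) (Fin 4) (ZMod n)) (hM : IsSymp M) (hMT : M ∉ T) :
    ∃ k, ∃ X ∈ T, ∃ Y ∈ T, X * M * Y = Smat n k := by
  obtain ⟨A, B, C, D, rfl⟩ := exists_eq_blocks M
  by_cases hA : A.det = 1
  · have hC : C.det = 0 := by
      have := hM.det_add_det_left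
      rw [hA] at this
      linear_combination this
    have hswap : D3 n * blocks A B C D = blocks C D A B := by
      simp [D3_eq_blocks, blocks_mul]
    have hs := isSymp_D3.mul hM
    rw [hswap] at hs
    have hT : blocks C D A B ∉ T := by
      intro h
      apply hMT
      have := T.mul_mem h₃ h
      rwa [← hswap, ← Matrix.mul_assoc, D3_mul_D3, Matrix.one_mul] at this
    obtain ⟨X, hX, Y, hY, e⟩ :=
      exists_mul_mul_eq_Smat_of_det_ne_one T h₁ h₂ h₃ hs hT (by simp [hC])
    have hj : (!![0, 1; -1, 0] : Matrix (Fin 2) (Fin 2) (ZMod n)).det = 1 := by simp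
    have hj' : (!![0, -1; 1, 0] : Matrix (Fin 2) (Fin 2) (ZMod n)).det = 1 := by simp
    have hL := blocks_diagonal_mem T h₁ h₂ h₃ _ _ hj hj
    have hR := blocks_diagonal_mem T h₁ h₂ h₃ _ _ hj hj'
    refine ⟨1, _, T.mul_mem (T.mul_mem hL h₃) (T.mul_mem hX h₃), _, T.mul_mem hY hR, ?_⟩
    rw [hC, ← hswap] at e
    simp only [Matrix.mul_assoc] at e ⊢
    rw [← Matrix.mul_assoc (blocks A B C D) Y, ← Matrix.mul_assoc (D3 n) (_ * Y),
      ← Matrix.mul_assoc X, e, Smat_eq_blocks, Smat_eq_blocks, D3_eq_blocks]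
    ext i j
    fin_cases i <;> fin_cases j <;> simp [blocks]
  · exact ⟨A.det, exists_mul_mul_eq_Smat_of_det_ne_one T h₁ h₂ h₃ hM hMT hA⟩

/-- For `n` prime, if `H` is the subgroup generated by `D₁, D₂, D₃` and
`M ∈ Sp(4, ℤ/nℤ)` with `M ∉ H`, then `G₁ M G₂ = S(k)` for some `k ∈ ℤ/nℤ` and
`G₁, G₂ ∈ H`. -/
theorem statement9 (n : ℕ) (hn : n.Prime)
    (d₁ d₂ d₃ : GL (Fin 4) (ZMod n))
    (h₁ : (d₁ : Matrix (Fin 4) (Fin 4) (ZMod n)) = D1 n)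
    (h₂ : (d₂ : Matrix (Fin 4) (Fin 4) (ZMod n)) = D2 n)
    (h₃ : (d₃ : Matrix (Fin 4) (Fin 4) (ZMod n)) = D3 n)
    (M : GL (Fin 4) (ZMod n))
    (hM : (M : Matrix (Fin 4) (Fin 4) (ZMod n))ᵀ * J4 n * (M : Matrix (Fin 4) (Fin 4) (ZMod n))
      = J4 n)
    (hMH : M ∉ Subgroup.closure {d₁, d₂, d₃}) :
    ∃ k : ZMod n, ∃ G₁ G₂ : GL (Fin 4) (ZMod n),
      G₁ ∈ Subgroup.closure {d₁, d₂, d₃} ∧ G₂ ∈ Subgroup.closure {d₁, d₂, d₃} ∧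
      ((G₁ * M * G₂ : GL (Fin 4) (ZMod n)) : Matrix (Fin 4) (Fin 4) (ZMod n)) = Smat n k := by
  have : Fact n.Prime := ⟨hn⟩
  obtain ⟨k, _, ⟨G₁, hG₁, rfl⟩, _, ⟨G₂, hG₂, rfl⟩, e⟩ := exists_mul_mul_eq_Smat
    ((Subgroup.closure {d₁, d₂, d₃}).toSubmonoid.map (Units.coeHom _))
    ⟨d₁, Subgroup.subset_closure (by simp), h₁⟩ ⟨d₂, Subgroup.subset_closure (by simp), h₂⟩
    ⟨d₃, Subgroup.subset_closure (by simp), h₃⟩ M hM (by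
      rintro ⟨g, hg, hgM⟩
      exact hMH (Units.ext hgM ▸ hg))
  exact ⟨k, G₁, G₂, hG₁, hG₂, by simpa using e⟩
end
end

section
/- Let n be a prime. For every k ∈ ℤ/nℤ, the matrix S(k) belongs to the subgroup of invertible 4×4 matrices over ℤ/nℤ generated by D₁, D₂, D₃, D₄. -/
open Matrix

noncomputable section

/-- Powers of `D4`. -/
theorem D4_pow (n m : ℕ) :
    D4 n ^ m = !![1,0,0,0; 0,1,0,-(m : ZMod n); (m : ZMod n),0,1,0; 0,0,0,1] := by
  induction m with
  | zero =>
    ext i j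
    fin_cases i <;> fin_cases j <;> simp
  | succ m ih =>
    rw [pow_succ, ih, D4]
    ext i j
    fin_cases i <;> fin_cases j <;> simp [Matrix.mul_apply, Fin.sum_univ_four, add_comm]

/-- Conjugating `D4` by the involution `D3` interchanges the two coordinate planes. -/
theorem D3_mul_D4_mul_D3 (n : ℕ) :
    D3 n * D4 n * D3 n = !![1,0,1,0; 0,1,0,0; 0,0,1,0; 0,-1,0,1] := by
  rw [D3, D4]
  ext i j
  fin_cases i <;> fin_cases j <;> simp [Matrix.mul_apply, Fin.sum_univ_four]

/-- For `n` prime and every `k ∈ ℤ/nℤ`, the matrix `S(k)` belongs to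
the subgroup of `GL(4, ℤ/nℤ)` generated by `D₁, D₂, D₃, D₄`. -/
theorem statement10 (n : ℕ) (hn : n.Prime)
    (d₁ d₂ d₃ d₄ : GL (Fin 4) (ZMod n))
    (h₁ : (d₁ : Matrix (Fin 4) (Fin 4) (ZMod n)) = D1 n)
    (h₂ : (d₂ : Matrix (Fin 4) (Fin 4) (ZMod n)) = D2 n)
    (h₃ : (d₃ : Matrix (Fin 4) (Fin 4) (ZMod n)) = D3 n)
    (h₄ : (d₄ : Matrix (Fin 4) (Fin 4) (ZMod n)) = D4 n)
    (k : ZMod n) :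
    ∃ u ∈ Subgroup.closure {d₁, d₂, d₃, d₄},
      (u : Matrix (Fin 4) (Fin 4) (ZMod n)) = Smat n k := by
  have : NeZero n := ⟨hn.ne_zero⟩
  obtain ⟨m, hm⟩ := ZMod.natCast_zmod_surjective (k - 1)
  have hk : k = m + 1 := by rw [hm]; ring
  have m₃ : d₃ ∈ Subgroup.closure {d₁, d₂, d₃, d₄} := Subgroup.subset_closure (by simp)
  have m₄ : d₄ ∈ Subgroup.closure {d₁, d₂, d₃, d₄} := Subgroup.subset_closure (by simp)
  refine ⟨d₄ ^ m * (d₃ * d₄ * d₃), mul_mem (pow_mem m₄ m) (mul_mem (mul_mem m₃ m₄) m₃), ?_⟩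
  simp only [Units.val_mul, Units.val_pow_eq_pow_val, h₃, h₄, D4_pow, D3_mul_D4_mul_D3, Smat, hk]
  ext i j
  fin_cases i <;> fin_cases j <;> simp [Matrix.mul_apply, Fin.sum_univ_four, add_comm]
end
end

section
/- Let n ≥ 2 be an integer. The subgroup of the group of invertible 4×4 matrices over ℤ/nℤ generated by D₁, D₂ and D₃ equals the set of all matrices of the form [[A,0],[0,B]] or [[0,A],[B,0]] (written in 2×2 blocks) with A, B ∈ SL(2, ℤ/nℤ). -/
open Matrix

noncomputable section

namespace Matrix

open scoped MatrixGroups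

theorem SpecialLinearGroup.coe_map_S (R : Type*) [CommRing R] :
    (SpecialLinearGroup.map (Int.castRingHom R) ModularGroup.S : Matrix (Fin 2) (Fin 2) R) =
      !![0, -1; 1, 0] := by
  rw [SpecialLinearGroup.map_apply_coe, ModularGroup.coe_S]
  ext i j
  fin_cases i <;> fin_cases j <;> simp

theorem SpecialLinearGroup.coe_map_S_inv (R : Type*) [CommRing R] :
    ((SpecialLinearGroup.map (Int.castRingHom R) ModularGroup.S)⁻¹ : SL(2, R)).1 =
      !![0, 1; -1, 0] := by
  rw [SpecialLinearGroup.coe_inv, SpecialLinearGroup.coe_map_S, adjugate_fin_two_of, neg_neg]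

theorem SpecialLinearGroup.coe_map_T_zpow (R : Type*) [CommRing R] (k : ℤ) :
    (SpecialLinearGroup.map (Int.castRingHom R) (ModularGroup.T ^ k) :
      Matrix (Fin 2) (Fin 2) R) = !![1, (k : R); 0, 1] := by
  rw [SpecialLinearGroup.map_apply_coe, ModularGroup.coe_T_zpow]
  ext i j
  fin_cases i <;> fin_cases j <;> simp

/-- If every element of `R` is an integer, then `SL(2, ℤ) → SL(2, R)` is surjective. -/
theorem SpecialLinearGroup.map_intCast_surjective {R : Type*} [CommRing R]
    (hR : Function.Surjective (Int.cast : ℤ → R)) :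
    Function.Surjective (SpecialLinearGroup.map (n := Fin 2) (Int.castRingHom R)) := by
  set H := (SpecialLinearGroup.map (n := Fin 2) (Int.castRingHom R)).range
  set S : SL(2, R) := SpecialLinearGroup.map (Int.castRingHom R) ModularGroup.S
  have hS : S ∈ H := ⟨_, rfl⟩
  have coe_S : S.1 = !![0, -1; 1, 0] := SpecialLinearGroup.coe_map_S R
  have coe_S_inv : (S⁻¹).1 = !![0, 1; -1, 0] := SpecialLinearGroup.coe_map_S_inv R
  let U (t : R) : SL(2, R) := ⟨!![1, t; 0, 1], by simp⟩
  have coe_U (t : R) : (U t).1 = !![1, t; 0, 1] := rfl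
  have hU (t : R) : U t ∈ H := by
    obtain ⟨k, rfl⟩ := hR t
    exact ⟨ModularGroup.T ^ k, Subtype.ext (SpecialLinearGroup.coe_map_T_zpow R k)⟩
  have upper (A : SL(2, R)) (hA : A 1 0 = 0) : A ∈ H := by
    have hdet : A 0 0 * A 1 1 = 1 := by
      have := A.det_coe
      rwa [det_fin_two, hA, mul_zero, sub_zero] at this
    have key : A = U (A 0 0) * S⁻¹ * U (A 1 1) * S * U (A 0 0) * S * U (A 1 1 * A 0 1) := by
      apply Subtype.ext
      simp only [SpecialLinearGroup.coe_mul, coe_S, coe_S_inv, coe_U]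
      ext i j
      fin_cases i <;> fin_cases j <;> simp [Matrix.mul_apply, Fin.sum_univ_two, hA] <;> grind
    rw [key]
    exact mul_mem (mul_mem (mul_mem (mul_mem (mul_mem (mul_mem (hU _) (inv_mem hS)) (hU _)) hS)
      (hU _)) hS) (hU _)
  have euclid (m : ℕ) : ∀ (x y : ℤ) (A : SL(2, R)), y.natAbs = m → A 0 0 = x → A 1 0 = y →
      A ∈ H := by
    induction m using Nat.strong_induction_on with
    | _ m ih =>
      rintro x y A rfl hx hy
      rcases eq_or_ne y 0 with rfl | hy0
      · exact upper A (by simpa using hy)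
      · have hlt : (x % y).natAbs < y.natAbs := by
          have h0 := Int.emod_nonneg x hy0
          have h1 := Int.emod_lt_abs x hy0
          rw [Int.abs_eq_natAbs] at h1
          omega
        have hmod : ((x % y : ℤ) : R) = x - (x / y : ℤ) * y := by
          rw [Int.emod_def]
          push_cast
          ring
        have hmem : S * U (-(x / y : ℤ)) * A ∈ H := by
          refine ih _ hlt (-y) (x % y) _ rfl ?_ ?_
          · simp [coe_S, coe_U, Matrix.mul_apply, Fin.sum_univ_two, hy]
          · simp [coe_S, coe_U, Matrix.mul_apply, Fin.sum_univ_two, hx, hy, hmod]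
            ring
        exact (Subgroup.mul_mem_cancel_left H (mul_mem hS (hU _))).mp hmem
  intro A
  obtain ⟨x, hx⟩ := hR (A 0 0)
  obtain ⟨y, hy⟩ := hR (A 1 0)
  exact euclid _ x y A rfl hx.symm hy.symm

/-- `SL(2, ℤ/nℤ)` is generated by the reductions of `S` and `T`. -/
theorem SpecialLinearGroup.eq_top_of_S_mem_of_T_mem {n : ℕ} {H : Subgroup SL(2, ZMod n)}
    (hS : SpecialLinearGroup.map (Int.castRingHom (ZMod n)) ModularGroup.S ∈ H)
    (hT : SpecialLinearGroup.map (Int.castRingHom (ZMod n)) ModularGroup.T ∈ H) : H = ⊤ := by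
  have h : Subgroup.closure {ModularGroup.S, ModularGroup.T} ≤
      H.comap (SpecialLinearGroup.map (Int.castRingHom (ZMod n))) := by
    rw [Subgroup.closure_le]
    rintro _ (rfl | rfl)
    exacts [hS, hT]
  rw [SpecialLinearGroup.SL2Z_generators, top_le_iff] at h
  rw [eq_top_iff]
  intro A _
  obtain ⟨B, rfl⟩ := SpecialLinearGroup.map_intCast_surjective ZMod.intCast_surjective A
  exact h.ge (Subgroup.mem_top B)

/-- The block diagonal embedding `(A, B) ↦ [[A, 0], [0, B]]`. -/
def blockDiagSL (R : Type*) [CommRing R] : SL(2, R) × SL(2, R) →* GL (Fin 4) R :=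
  MonoidHom.toHomUnits
    { toFun := fun p => reindex finSumFinEquiv finSumFinEquiv
        (fromBlocks (p.1 : Matrix (Fin 2) (Fin 2) R) 0 0 (p.2 : Matrix (Fin 2) (Fin 2) R))
      map_one' := by simp [fromBlocks_one]
      map_mul' := fun p q => by simp [fromBlocks_multiply] }

theorem coe_blockDiagSL {R : Type*} [CommRing R] (A B : SL(2, R)) :
    (blockDiagSL R (A, B) : Matrix (Fin 4) (Fin 4) R) =
      reindex finSumFinEquiv finSumFinEquiv
        (fromBlocks (A : Matrix (Fin 2) (Fin 2) R) 0 0 (B : Matrix (Fin 2) (Fin 2) R)) := rfl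

end Matrix

theorem D1_eq_reindex_fromBlocks (n : ℕ) :
    D1 n = reindex finSumFinEquiv finSumFinEquiv
      (fromBlocks !![1, 1; 0, 1] 0 0 1 : Matrix (Fin 2 ⊕ Fin 2) (Fin 2 ⊕ Fin 2) (ZMod n)) := by
  ext i j
  fin_cases i <;> fin_cases j <;> rfl

theorem D2_eq_reindex_fromBlocks (n : ℕ) :
    D2 n = reindex finSumFinEquiv finSumFinEquiv
      (fromBlocks !![0, 1; -1, 0] 0 0 1 : Matrix (Fin 2 ⊕ Fin 2) (Fin 2 ⊕ Fin 2) (ZMod n)) := by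
  ext i j
  fin_cases i <;> fin_cases j <;> rfl

theorem D3_eq_reindex_fromBlocks (n : ℕ) :
    D3 n = reindex finSumFinEquiv finSumFinEquiv
      (fromBlocks 0 1 1 0 : Matrix (Fin 2 ⊕ Fin 2) (Fin 2 ⊕ Fin 2) (ZMod n)) := by
  ext i j
  fin_cases i <;> fin_cases j <;> rfl

/-- For `n ≥ 2`, the subgroup of `GL(4, ℤ/nℤ)` generated by `D₁, D₂, D₃`
equals the set of matrices of the block form `[[A,0],[0,B]]` or `[[0,A],[B,0]]` with
`A, B ∈ SL(2, ℤ/nℤ)`. -/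
theorem statement12 (n : ℕ) (hn : 2 ≤ n)
    (d₁ d₂ d₃ : GL (Fin 4) (ZMod n))
    (h₁ : (d₁ : Matrix (Fin 4) (Fin 4) (ZMod n)) = D1 n)
    (h₂ : (d₂ : Matrix (Fin 4) (Fin 4) (ZMod n)) = D2 n)
    (h₃ : (d₃ : Matrix (Fin 4) (Fin 4) (ZMod n)) = D3 n) :
    (fun u : GL (Fin 4) (ZMod n) => (u : Matrix (Fin 4) (Fin 4) (ZMod n))) ''
        (Subgroup.closure {d₁, d₂, d₃} : Set (GL (Fin 4) (ZMod n)))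
      = {X : Matrix (Fin 4) (Fin 4) (ZMod n) |
          (∃ A B : Matrix (Fin 2) (Fin 2) (ZMod n), A.det = 1 ∧ B.det = 1 ∧
            X = Matrix.reindex finSumFinEquiv finSumFinEquiv (Matrix.fromBlocks A 0 0 B)) ∨
          (∃ A B : Matrix (Fin 2) (Fin 2) (ZMod n), A.det = 1 ∧ B.det = 1 ∧
            X = Matrix.reindex finSumFinEquiv finSumFinEquiv (Matrix.fromBlocks 0 A B 0))} := by
  have e₁ : d₁ = blockDiagSL (ZMod n)
      (SpecialLinearGroup.map (Int.castRingHom (ZMod n)) ModularGroup.T, 1) := by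
    ext1
    rw [h₁, D1_eq_reindex_fromBlocks, coe_blockDiagSL]
    have hT := SpecialLinearGroup.coe_map_T_zpow (ZMod n) 1
    rw [zpow_one, Int.cast_one] at hT
    rw [hT]
    rfl
  have e₂ : d₂ = blockDiagSL (ZMod n)
      (SpecialLinearGroup.map (Int.castRingHom (ZMod n)) ModularGroup.S⁻¹, 1) := by
    ext1
    rw [h₂, D2_eq_reindex_fromBlocks, coe_blockDiagSL]
    rw [map_inv, SpecialLinearGroup.coe_map_S_inv]
    rfl
  have hsq : d₃ * d₃ = 1 := by
    ext1
    simp [h₃, D3_eq_reindex_fromBlocks, fromBlocks_multiply, fromBlocks_one]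
  have hcomm (A B) : d₃ * blockDiagSL (ZMod n) (A, B) = blockDiagSL (ZMod n) (B, A) * d₃ := by
    ext1
    simp [h₃, D3_eq_reindex_fromBlocks, coe_blockDiagSL, fromBlocks_multiply]
  have hswap (A B : SpecialLinearGroup (Fin 2) (ZMod n)) :
      ((blockDiagSL (ZMod n) (A, B) * d₃ : GL (Fin 4) (ZMod n)) :
        Matrix (Fin 4) (Fin 4) (ZMod n)) = reindex finSumFinEquiv finSumFinEquiv
        (fromBlocks 0 A.1 B.1 0 : Matrix (Fin 2 ⊕ Fin 2) (Fin 2 ⊕ Fin 2) (ZMod n)) := by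
    simp [h₃, D3_eq_reindex_fromBlocks, coe_blockDiagSL, fromBlocks_multiply]
  have mem₃ : d₃ ∈ Subgroup.closure {d₁, d₂, d₃} := Subgroup.subset_closure (by simp)
  have left_mem (A) : blockDiagSL (ZMod n) (A, 1) ∈ Subgroup.closure {d₁, d₂, d₃} := by
    have htop : (Subgroup.closure {d₁, d₂, d₃}).comap
        ((blockDiagSL (ZMod n)).comp (MonoidHom.inl _ _)) = ⊤ := by
      apply SpecialLinearGroup.eq_top_of_S_mem_of_T_mem
      · rw [← inv_mem_iff, ← map_inv]
        exact e₂ ▸ Subgroup.subset_closure (by simp)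
      · exact e₁ ▸ Subgroup.subset_closure (by simp)
    exact htop.ge (Subgroup.mem_top A)
  have diag_mem (A B) : blockDiagSL (ZMod n) (A, B) ∈ Subgroup.closure {d₁, d₂, d₃} := by
    have h : blockDiagSL (ZMod n) (A, B) =
        blockDiagSL (ZMod n) (A, 1) * (d₃ * blockDiagSL (ZMod n) (B, 1) * d₃) := by
      rw [hcomm, mul_assoc, hsq, mul_one, ← map_mul]
      simp
    rw [h]
    exact mul_mem (left_mem A) (mul_mem (mul_mem mem₃ (left_mem B)) mem₃)
  have closure_form (u : GL (Fin 4) (ZMod n)) (hu : u ∈ Subgroup.closure {d₁, d₂, d₃}) :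
      ∃ A B, u = blockDiagSL (ZMod n) (A, B) ∨ u = blockDiagSL (ZMod n) (A, B) * d₃ := by
    induction hu using Subgroup.closure_induction with
    | mem u hu =>
      rcases hu with rfl | rfl | rfl
      · exact ⟨_, _, .inl e₁⟩
      · exact ⟨_, _, .inl e₂⟩
      · exact ⟨1, 1, .inr (by rw [← Prod.one_eq_mk, map_one, one_mul])⟩
    | one => exact ⟨1, 1, .inl (by rw [← Prod.one_eq_mk, map_one])⟩
    | mul u v _ _ hu hv =>
      obtain ⟨A, B, rfl | rfl⟩ := hu <;> obtain ⟨C, D, rfl | rfl⟩ := hv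
      · exact ⟨A * C, B * D, .inl (by rw [← map_mul, Prod.mk_mul_mk])⟩
      · exact ⟨A * C, B * D, .inr (by rw [← mul_assoc, ← map_mul, Prod.mk_mul_mk])⟩
      · exact ⟨A * D, B * C, .inr (by
          rw [mul_assoc, hcomm, ← mul_assoc, ← map_mul, Prod.mk_mul_mk])⟩
      · exact ⟨A * D, B * C, .inl (by
          rw [mul_assoc, ← mul_assoc d₃, hcomm, mul_assoc, hsq, mul_one, ← map_mul,
            Prod.mk_mul_mk])⟩
    | inv u _ hu =>
      obtain ⟨A, B, rfl | rfl⟩ := hu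
      · exact ⟨A⁻¹, B⁻¹, .inl (by rw [← map_inv, Prod.inv_mk])⟩
      · exact ⟨B⁻¹, A⁻¹, .inr (by
          rw [_root_.mul_inv_rev, inv_eq_of_mul_eq_one_left hsq, ← map_inv, Prod.inv_mk, hcomm])⟩
  ext X
  constructor
  · rintro ⟨u, hu, rfl⟩
    obtain ⟨A, B, rfl | rfl⟩ := closure_form u hu
    · exact .inl ⟨A, B, A.det_coe, B.det_coe, rfl⟩
    · exact .inr ⟨A, B, A.det_coe, B.det_coe, hswap A B⟩
  · rintro (⟨A, B, hA, hB, rfl⟩ | ⟨A, B, hA, hB, rfl⟩)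
    · exact ⟨_, diag_mem ⟨A, hA⟩ ⟨B, hB⟩, rfl⟩
    · exact ⟨_, mul_mem (diag_mem ⟨A, hA⟩ ⟨B, hB⟩) mem₃, hswap _ _⟩
end
end

section
/- Let n ≥ 2 be an integer and define B₄ ∈ ℂ^{n²×n²} by (B₄)_{pq} = δ_{(p₁−p₂ mod n), q₁}·δ_{p₂q₂}, where p = p₁n + p₂, q = q₁n + q₂ with p₁,p₂,q₁,q₂ ∈ {0,…,n−1}. Then B₄ is invertible and B₄⁻¹ (P⊗I) B₄ = P⊗P, B₄⁻¹ (Q⊗I) B₄ = Q⊗I, B₄⁻¹ (I⊗P) B₄ = I⊗P, and B₄⁻¹ (I⊗Q) B₄ = Q⁻¹⊗Q. -/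
open Matrix Kronecker

noncomputable section

/-- The matrix `B₄` with entries `(B₄)_{(p₁,p₂),(q₁,q₂)} = δ_{(p₁−p₂ mod n) q₁} δ_{p₂q₂}`
(subtraction in `Fin n` is taken modulo `n`). -/
def B4 (n : ℕ) : Matrix (Fin n × Fin n) (Fin n × Fin n) ℂ :=
  Matrix.of fun p q => if p.1 - p.2 = q.1 ∧ p.2 = q.2 then 1 else 0

/-- The shear `(q₁, q₂) ↦ (q₁ + q₂, q₂)` of `ℤ/n × ℤ/n`. -/
def shear (n : ℕ) [NeZero n] : Fin n × Fin n ≃ Fin n × Fin n where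
  toFun q := (q.1 + q.2, q.2)
  invFun p := (p.1 - p.2, p.2)
  left_inv q := by simp
  right_inv p := by simp

lemma B4_eq_submatrix_one (n : ℕ) [NeZero n] :
    B4 n = (1 : Matrix (Fin n × Fin n) (Fin n × Fin n) ℂ).submatrix (shear n).symm id := by
  ext p q
  simp [B4, shear, Matrix.one_apply, Prod.ext_iff]

lemma B4_mul_submatrix_one (n : ℕ) [NeZero n] :
    B4 n * (1 : Matrix (Fin n × Fin n) (Fin n × Fin n) ℂ).submatrix (shear n) id = 1 := by
  rw [B4_eq_submatrix_one]
  ext p q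
  simp [Matrix.mul_apply, Matrix.one_apply, ← Equiv.eq_symm_apply]

lemma isUnit_B4 (n : ℕ) [NeZero n] : IsUnit (B4 n) :=
  IsUnit.of_mul_eq_one _ (B4_mul_submatrix_one n)

/-- Conjugation by `B₄` relabels the indices along the shear. -/
lemma B4_inv_mul_mul_B4 (n : ℕ) [NeZero n]
    (M : Matrix (Fin n × Fin n) (Fin n × Fin n) ℂ) :
    (B4 n)⁻¹ * M * B4 n = M.submatrix (shear n) (shear n) := by
  have hB : B4 n = (1 : Matrix (Fin n × Fin n) (Fin n × Fin n) ℂ).submatrix id (shear n) := by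
    ext p q
    simp [B4_eq_submatrix_one, Matrix.one_apply, Equiv.symm_apply_eq]
  rw [Matrix.inv_eq_right_inv (B4_mul_submatrix_one n), hB]
  ext p q
  simp [Matrix.mul_apply, Matrix.one_apply]

lemma Qmat_apply (n : ℕ) [NeZero n] (i j : Fin n) :
    Qmat n i j = if j = i + 1 then 1 else 0 := by
  simp [Qmat, Fin.ext_iff, Fin.val_add]

lemma Qmat_inv (n : ℕ) [NeZero n] : (Qmat n)⁻¹ = (Qmat n)ᵀ := by
  apply Matrix.inv_eq_right_inv
  ext i j
  simp [Matrix.mul_apply, Qmat_apply, Matrix.one_apply, eq_comm]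

lemma ω_pow_self (n : ℕ) [NeZero n] : ω n ^ n = 1 :=
  (Complex.isPrimitiveRoot_exp n (NeZero.ne n)).pow_eq_one

lemma ω_pow_val_add (n : ℕ) [NeZero n] (i j : Fin n) :
    ω n ^ ((i + j : Fin n) : ℕ) = ω n ^ (i : ℕ) * ω n ^ (j : ℕ) := by
  rw [Fin.val_add, ← pow_eq_pow_mod _ (ω_pow_self n), pow_add]

/-- `B₄` is invertible and `B₄⁻¹ (P⊗I) B₄ = P⊗P`,
`B₄⁻¹ (Q⊗I) B₄ = Q⊗I`, `B₄⁻¹ (I⊗P) B₄ = I⊗P`, `B₄⁻¹ (I⊗Q) B₄ = Q⁻¹⊗Q`. -/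
theorem statement16 (n : ℕ) (hn : 2 ≤ n) :
    IsUnit (B4 n) ∧
    (B4 n)⁻¹ * (Pmat n ⊗ₖ (1 : Matrix (Fin n) (Fin n) ℂ)) * B4 n = Pmat n ⊗ₖ Pmat n ∧
    (B4 n)⁻¹ * (Qmat n ⊗ₖ (1 : Matrix (Fin n) (Fin n) ℂ)) * B4 n
      = Qmat n ⊗ₖ (1 : Matrix (Fin n) (Fin n) ℂ) ∧
    (B4 n)⁻¹ * ((1 : Matrix (Fin n) (Fin n) ℂ) ⊗ₖ Pmat n) * B4 n
      = (1 : Matrix (Fin n) (Fin n) ℂ) ⊗ₖ Pmat n ∧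
    (B4 n)⁻¹ * ((1 : Matrix (Fin n) (Fin n) ℂ) ⊗ₖ Qmat n) * B4 n
      = (Qmat n)⁻¹ ⊗ₖ Qmat n := by
  have : NeZero n := ⟨by omega⟩
  simp only [B4_inv_mul_mul_B4]
  refine ⟨isUnit_B4 n, ?_, ?_, ?_, ?_⟩ <;> ext ⟨a, b⟩ ⟨c, d⟩
  · by_cases h : b = d
    · subst h
      by_cases h' : a = c
      · subst h'
        simp [shear, Pmat, ω_pow_val_add]
      · simp [shear, Pmat, h']
    · simp [shear, Pmat, h]
  · by_cases h : b = d
    · subst h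
      simp [shear, Qmat_apply, add_right_comm a b 1]
    · simp [shear, h]
  · by_cases h : b = d
    · subst h
      simp [shear, Pmat, Matrix.one_apply]
    · simp [shear, Pmat, h]
  · by_cases h : d = b + 1
    · subst h
      have : a + b = c + (b + 1) ↔ a = c + 1 := by
        rw [← add_assoc, add_right_comm, add_left_inj]
      simp [shear, Qmat_apply, Qmat_inv, Matrix.one_apply, this]
    · simp [shear, Qmat_apply, h]
end
end
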